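/- For every integer n ≥ 1 and every Boolean function f of n variables, the limit P_n(f) = lim_{m→∞} P_{m,n}(f) exists and is strictly positive. -/

import Mathlib

/-- An and/or tree skeleton: leaves carry a variable index and a polarity
(`true` = positive literal, `false` = negated literal); internal nodes carry
a connective (`true` = AND, `false` = OR) and a list of children. -/
inductive AT (n : ℕ) : Type
  | leaf : Fin n → Bool → AT n
  | node : Bool → List (AT n) → AT n

namespace AT

/-- The connective at the root, if the root is an internal node. -/
def rootConn {n : ℕ} : AT n → Option Bool
  | .leaf _ _ => none
  | .node c _ => some c

/-- Whether a tree is a single leaf. -/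
def isLeafB {n : ℕ} : AT n → Bool
  | .leaf _ _ => true
  | .node _ _ => false

/-- The children of the root. -/
def rootChildren {n : ℕ} : AT n → List (AT n)
  | .leaf _ _ => []
  | .node _ ts => ts

/-- Well-formedness: an associative tree is a plane tree in which each internal
node has at least two children, no internal node has the same connective as its
parent (stratification), and leaves carry literals. -/
inductive WF {n : ℕ} : AT n → Prop
  | leaf (i : Fin n) (b : Bool) : WF (.leaf i b)
  | node (c : Bool) (ts : List (AT n)) :
      2 ≤ ts.length → (∀ t ∈ ts, WF t) → (∀ t ∈ ts, rootConn t ≠ some c) →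
      WF (.node c ts)

mutual
/-- The size of a tree: its total number of nodes. -/
def size {n : ℕ} : AT n → ℕ
  | .leaf _ _ => 1
  | .node _ ts => 1 + sizeList ts
def sizeList {n : ℕ} : List (AT n) → ℕ
  | [] => 0
  | t :: ts => size t + sizeList ts
end

mutual
/-- The Boolean function computed by a tree. -/
def eval {n : ℕ} : AT n → (Fin n → Bool) → Bool
  | .leaf i b, x => if b then x i else ! x i
  | .node c ts, x => evalList c ts x
def evalList {n : ℕ} : Bool → List (AT n) → (Fin n → Bool) → Bool
  | c, [], _ => c
  | c, t :: ts, x => if c then eval t x && evalList c ts x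
                     else eval t x || evalList c ts x
end

end AT

open AT

/-- Number of associative trees of size `m` in a family `𝒯`. -/
noncomputable def countIn (n : ℕ) (𝒯 : Set (AT n)) (m : ℕ) : ℕ :=
  Nat.card {t : AT n // t ∈ 𝒯 ∧ WF t ∧ size t = m}

/-- `A n m` is the number of associative trees of size `m` on `n` variables. -/
noncomputable def A (n m : ℕ) : ℕ := countIn n Set.univ m

/-- `Pmn n m f` is the proportion, among associative trees of size `m` on `n`
variables, of those computing the Boolean function `f`. -/
noncomputable def Pmn (n m : ℕ) (f : (Fin n → Bool) → Bool) : ℝ :=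
  (countIn n {t | eval t = f} m : ℝ) / (A n m : ℝ)

/-- Ratio of trees of size `m` in the family `𝒯` among all trees of size `m`. -/
noncomputable def ratio (n : ℕ) (𝒯 : Set (AT n)) (m : ℕ) : ℝ :=
  (countIn n 𝒯 m : ℝ) / (A n m : ℝ)

/-- `HasLimRatio n 𝒯 μ` : the limiting ratio of the family `𝒯` exists and is `μ`. -/
def HasLimRatio (n : ℕ) (𝒯 : Set (AT n)) (μ : ℝ) : Prop :=
  Filter.Tendsto (ratio n 𝒯) Filter.atTop (nhds μ)

/-- Extension of a Boolean function of `n₀` variables to `n ≥ n₀` variables. -/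
def extend {n₀ n : ℕ} (h : n₀ ≤ n) (f : (Fin n₀ → Bool) → Bool) :
    (Fin n → Bool) → Bool :=
  fun x => f (fun j => x (Fin.castLE h j))

open Classical in
/-- The tree size complexity of a Boolean function. -/
noncomputable def Lcomp (n : ℕ) (f : (Fin n → Bool) → Bool) : ℕ :=
  if f = (fun _ => true) ∨ f = (fun _ => false) then 0
  else if ∃ i : Fin n, f = (fun x => x i) ∨ f = (fun x => ! x i) then 2
  else sInf {m | ∃ t : AT n, WF t ∧ size t = m ∧ eval t = f}

open Filter Topology

lemma dom_bound (a : ℕ → ℝ) (ρ r : ℝ) (hρ : 0 < ρ) (hρr : ρ < r) (apos : ∀ m, 0 < a m)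
    (hr : Tendsto (fun m => a m / a (m+1)) atTop (𝓝 ρ)) :
    ∃ C : ℝ, 0 < C ∧ ∀ j k, a j ≤ C * r^k * a (j+k) := by
  have r0 : 0 < r := hρ.trans hρr
  obtain ⟨N, hN⟩ := eventually_atTop.1 (hr.eventually (gt_mem_nhds hρr))
  set w : ℕ → ℝ := fun j => a j * r^j with hw
  have wpos : ∀ j, 0 < w j := fun j => mul_pos (apos j) (pow_pos r0 j)
  have hmono : ∀ k j, N ≤ j → w j ≤ w (j+k) := by
    intro k
    induction k with
    | zero => intro j _; simp
    | succ k ih =>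
      intro j hj
      refine (ih j hj).trans ?_
      have h1 := hN (j+k) (by omega)
      have h2 : a (j+k) < r * a (j+k+1) := by
        rwa [div_lt_iff₀ (apos _)] at h1
      simp only [hw]
      rw [← add_assoc, pow_succ r (j+k)]
      nlinarith [pow_pos r0 (j+k)]
  set Cc : ℝ := ∑ i ∈ Finset.range (N+1), ∑ j ∈ Finset.range (N+1), w i / w j with hC
  have hCc : ∀ i j, i ≤ N → j ≤ N → w i ≤ Cc * w j := by
    intro i j hi hj
    rw [← div_le_iff₀ (wpos j)]
    refine le_trans ?_ (Finset.single_le_sum (f := fun i => ∑ j ∈ Finset.range (N+1), w i / w j)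
      (fun i _ => Finset.sum_nonneg fun j _ => (div_pos (wpos i) (wpos j)).le) 
      (Finset.mem_range.2 (Nat.lt_succ_of_le hi)))
    exact Finset.single_le_sum (f := fun j => w i / w j)
      (fun j _ => (div_pos (wpos i) (wpos j)).le) (Finset.mem_range.2 (Nat.lt_succ_of_le hj))
  have hCc1 : 1 ≤ Cc := by
    have := hCc 0 0 (Nat.zero_le _) (Nat.zero_le _)
    have := wpos 0
    nlinarith
  refine ⟨Cc, by linarith, ?_⟩
  intro j k
  have key : w j ≤ Cc * w (j+k) := by
    by_cases hj : N ≤ j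
    · have := hmono k j hj
      have := wpos (j+k)
      nlinarith
    · by_cases hjk : j + k ≤ N
      · exact hCc _ _ (by omega) hjk
      · have h1 := hCc j N (by omega) le_rfl
        have h2 := hmono (j+k-N) N le_rfl
        rw [show N + (j+k-N) = j+k by omega] at h2
        nlinarith
  simp only [hw] at key
  rw [pow_add] at key
  have := pow_pos r0 j
  have h3 : a j * r^j ≤ (Cc * r^k * a (j+k)) * r^j := by linarith
  exact le_of_mul_le_mul_right h3 this

lemma ratio_pow (a : ℕ → ℝ) (ρ : ℝ) (apos : ∀ᶠ m in atTop, 0 < a m)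
    (hr : Tendsto (fun m => a m / a (m+1)) atTop (𝓝 ρ)) (k : ℕ) :
    Tendsto (fun m => a m / a (m+k)) atTop (𝓝 (ρ^k)) := by
  induction k with
  | zero =>
    simp only [add_zero, pow_zero]
    refine tendsto_const_nhds.congr' ?_
    filter_upwards [apos] with m hm
    rw [div_self hm.ne']
  | succ k ih =>
    have h2 := ih.mul (hr.comp (tendsto_add_atTop_nat k))
    rw [pow_succ]
    refine h2.congr' ?_
    have h3 := (tendsto_add_atTop_nat k).eventually apos
    filter_upwards [h3] with m hm
    simp only [Function.comp]
    rw [div_mul_div_cancel₀ hm.ne', add_assoc]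

lemma tannery (a h : ℕ → ℝ) (ρ r : ℝ) (hρ : 0 < ρ) (hρr : ρ < r) (apos : ∀ m, 0 < a m)
    (hr : Tendsto (fun m => a m / a (m+1)) atTop (𝓝 ρ))
    (hs : Summable fun k => ‖h k * r^k‖) :
    Tendsto (fun m => (∑ p ∈ Finset.HasAntidiagonal.antidiagonal m, a p.1 * h p.2) / a m) atTop
      (𝓝 (∑' k, h k * ρ^k)) := by
  obtain ⟨C, hC, hb⟩ := dom_bound a ρ r hρ hρr apos hr
  have r0 : 0 < r := hρ.trans hρr
  have e : ∀ m, (∑ p ∈ Finset.HasAntidiagonal.antidiagonal m, a p.1 * h p.2) / a m =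
      ∑' k, if k ≤ m then a (m-k) * h k / a m else 0 := by
    intro m
    rw [tsum_eq_sum (s := Finset.range (m+1))]
    · rw [← Finset.Nat.sum_antidiagonal_swap, Finset.Nat.sum_antidiagonal_eq_sum_range_succ_mk, Finset.sum_div]
      refine Finset.sum_congr rfl fun k hk => ?_
      rw [if_pos (by simpa [Nat.lt_succ_iff] using hk)]
      simp
    · intro k hk
      rw [if_neg (by simpa [Nat.lt_succ_iff] using hk)]
  simp_rw [e]
  refine tendsto_tsum_of_dominated_convergence (bound := fun k => C * ‖h k * r^k‖)
    (hs.mul_left C) ?_ ?_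
  · intro k
    have h1 := (ratio_pow a ρ (Eventually.of_forall apos) hr k).const_mul (h k)
    rw [← tendsto_add_atTop_iff_nat k]
    refine h1.congr fun m => ?_
    rw [if_pos (by omega), Nat.add_sub_cancel]
    ring
  · refine Eventually.of_forall fun m k => ?_
    split_ifs with hk
    · have h1 := hb (m-k) k
      rw [Nat.sub_add_cancel hk] at h1
      rw [norm_div, norm_mul, norm_mul, Real.norm_of_nonneg (apos _).le, Real.norm_of_nonneg (apos _).le,
        Real.norm_of_nonneg (pow_pos r0 k).le, div_le_iff₀ (apos m)]
      have := norm_nonneg (h k)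
      nlinarith
    · simp only [norm_zero]; positivity

def Sm (r : ℝ) (F : PowerSeries ℝ) : Prop := Summable fun k => ‖PowerSeries.coeff k F * r^k‖
noncomputable def ev (r : ℝ) (F : PowerSeries ℝ) : ℝ := ∑' k, PowerSeries.coeff k F * r^k

lemma coeff_mul_aux (r : ℝ) (F G : PowerSeries ℝ) (m : ℕ) :
    PowerSeries.coeff m (F*G) * r^m = ∑ p ∈ Finset.HasAntidiagonal.antidiagonal m,
      (PowerSeries.coeff p.1 F * r^p.1) * (PowerSeries.coeff p.2 G * r^p.2) := by
  rw [PowerSeries.coeff_mul, Finset.sum_mul]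
  refine Finset.sum_congr rfl fun p hp => ?_
  rw [← Finset.HasAntidiagonal.mem_antidiagonal.1 hp, pow_add]; ring

lemma Sm.mul {r : ℝ} {F G : PowerSeries ℝ} (hF : Sm r F) (hG : Sm r G) : Sm r (F*G) := by
  unfold Sm
  have h := summable_norm_sum_mul_antidiagonal_of_summable_norm
    (f := fun k => PowerSeries.coeff k F * r^k) (g := fun k => PowerSeries.coeff k G * r^k) hF hG
  exact h.congr fun m => by rw [coeff_mul_aux]

lemma ev_mul {r : ℝ} {F G : PowerSeries ℝ} (hF : Sm r F) (hG : Sm r G) :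
    ev r (F*G) = ev r F * ev r G := by
  unfold ev
  simp_rw [coeff_mul_aux]
  exact (tsum_mul_tsum_eq_tsum_sum_antidiagonal_of_summable_norm hF hG).symm

lemma Sm.add {r : ℝ} {F G : PowerSeries ℝ} (hF : Sm r F) (hG : Sm r G) : Sm r (F+G) := by
  unfold Sm
  simp_rw [map_add, add_mul]
  exact ((Summable.of_norm hF).add (Summable.of_norm hG)).norm

lemma Sm.sub {r : ℝ} {F G : PowerSeries ℝ} (hF : Sm r F) (hG : Sm r G) : Sm r (F-G) := by
  unfold Sm
  simp_rw [map_sub, sub_mul]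
  exact ((Summable.of_norm hF).sub (Summable.of_norm hG)).norm

lemma ev_add {r : ℝ} {F G : PowerSeries ℝ} (hF : Sm r F) (hG : Sm r G) :
    ev r (F+G) = ev r F + ev r G := by
  unfold ev
  simp_rw [map_add, add_mul]
  exact (Summable.of_norm hF).tsum_add (Summable.of_norm hG)

lemma ev_sub {r : ℝ} {F G : PowerSeries ℝ} (hF : Sm r F) (hG : Sm r G) :
    ev r (F-G) = ev r F - ev r G := by
  unfold ev
  simp_rw [map_sub, sub_mul]
  exact (Summable.of_norm hF).tsum_sub (Summable.of_norm hG)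

lemma Sm_C (r x : ℝ) : Sm r (PowerSeries.C x) := by
  refine summable_of_ne_finset_zero (s := {0}) fun k hk => ?_
  have : k ≠ 0 := by simpa using hk
  simp [PowerSeries.coeff_C, this]

lemma Sm_one (r : ℝ) : Sm r 1 := by simpa using Sm_C r 1

lemma ev_C (r x : ℝ) : ev r (PowerSeries.C x) = x := by
  unfold ev
  rw [tsum_eq_single 0]
  · simp
  · intro k hk; simp [PowerSeries.coeff_C, hk]

lemma ev_one (r : ℝ) : ev r 1 = 1 := by simpa using ev_C r 1

lemma Sm_X (r : ℝ) : Sm r PowerSeries.X := by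
  refine summable_of_ne_finset_zero (s := {1}) fun k hk => ?_
  have : k ≠ 1 := by simpa using hk
  simp [PowerSeries.coeff_X, this]

lemma ev_X (r : ℝ) : ev r PowerSeries.X = r := by
  unfold ev
  rw [tsum_eq_single 1]
  · simp
  · intro k hk; simp [PowerSeries.coeff_X, hk]

noncomputable def catS (γ : ℝ) : PowerSeries ℝ := PowerSeries.mk fun k => (catalan k : ℝ) * (γ/4)^k

lemma catS_eq (γ : ℝ) : catS γ = 1 + PowerSeries.C (γ/4) * PowerSeries.X * (catS γ * catS γ) := by
  ext m
  cases m with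
  | zero => simp [catS]
  | succ m =>
    rw [map_add, mul_assoc, PowerSeries.coeff_C_mul, PowerSeries.coeff_succ_X_mul,
      PowerSeries.coeff_mul]
    simp only [catS, PowerSeries.coeff_mk, PowerSeries.coeff_one]
    rw [catalan_succ']
    simp only [Nat.cast_sum, Nat.cast_mul, Nat.succ_ne_zero, if_false, zero_add]
    rw [Finset.sum_mul, Finset.mul_sum]
    refine Finset.sum_congr rfl fun p hp => ?_
    rw [← Finset.HasAntidiagonal.mem_antidiagonal.1 hp, pow_succ, pow_add]; ring

noncomputable def sqS (γ : ℝ) : PowerSeries ℝ := 1 - PowerSeries.C (γ/2) * PowerSeries.X * catS γ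

lemma sqS_sq (γ : ℝ) : sqS γ * sqS γ = 1 - PowerSeries.C γ * PowerSeries.X := by
  have h := catS_eq γ
  have h2 : PowerSeries.C (γ/2) = 2 * PowerSeries.C (γ/4) := by
    rw [show (2:PowerSeries ℝ) = PowerSeries.C 2 from (map_ofNat _ 2).symm, ← map_mul]; congr 1; ring
  have h4 : PowerSeries.C γ = 4 * PowerSeries.C (γ/4) := by
    rw [show (4:PowerSeries ℝ) = PowerSeries.C 4 from (map_ofNat _ 4).symm, ← map_mul]; congr 1; ring
  unfold sqS
  rw [h2, h4]
  linear_combination (-4 * PowerSeries.C (γ/4) * PowerSeries.X) * h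

/-- normalized Catalan numbers -/
lemma cat_rec (m : ℕ) : ((m:ℝ)+2) * catalan (m+1) = 2 * (2*m+1) * catalan m := by
  have h1 := succ_mul_catalan_eq_centralBinom m
  have h2 := succ_mul_catalan_eq_centralBinom (m+1)
  have h3 := Nat.succ_mul_centralBinom_succ m
  have h1' : ((m:ℝ)+1) * catalan m = Nat.centralBinom m := by exact_mod_cast h1
  have h2' : ((m:ℝ)+1+1) * catalan (m+1) = Nat.centralBinom (m+1) := by exact_mod_cast h2
  have h3' : ((m:ℝ)+1) * Nat.centralBinom (m+1) = 2 * (2*m+1) * Nat.centralBinom m := by exact_mod_cast h3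
  have : ((m:ℝ)+1) ≠ 0 := by positivity
  apply mul_left_cancel₀ this
  rw [← h1', ← h2'] at h3'
  linarith

lemma cat_pos (m : ℕ) : (0:ℝ) < catalan m := by
  have h1 := succ_mul_catalan_eq_centralBinom m
  have h2 := Nat.centralBinom_pos m
  have : 0 < catalan m := by
    rcases Nat.eq_zero_or_pos (catalan m) with h | h
    · rw [h] at h1; omega
    · exact h
  exact_mod_cast this

lemma cat_le (m : ℕ) : (catalan m : ℝ) ≤ 4^m := by
  induction m with
  | zero => simp
  | succ m ih =>
    have := cat_rec m
    have := cat_pos m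
    have h0 : (0:ℝ) ≤ m := Nat.cast_nonneg m
    rw [pow_succ]
    by_contra hc
    push Not at hc
    nlinarith

lemma cat_summable : Summable fun m : ℕ => (catalan m : ℝ) / 4^m := by
  refine summable_of_sum_range_le (c := 2) (fun m => (div_pos (cat_pos m) (by positivity)).le) ?_
  have : ∀ N : ℕ, ∑ m ∈ Finset.range N, (catalan m : ℝ)/4^m = 2 - 2 * ((N+1) * catalan N / 4^N) := by
    intro N
    induction N with
    | zero => simp
    | succ N ih =>
      rw [Finset.sum_range_succ, ih]
      have := cat_rec N
      rw [pow_succ]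
      push_cast
      field_simp
      linarith
  intro N
  rw [this]
  have := cat_pos N
  have : 0 ≤ ((N:ℝ)+1) * catalan N / 4^N := by positivity
  linarith

lemma cat_ratio : Tendsto (fun m => (catalan m : ℝ) / catalan (m+1)) atTop (𝓝 (1/4)) := by
  have e : ∀ m : ℕ, (catalan m : ℝ) / catalan (m+1) = (m+2)/(2*(2*m+1)) := by
    intro m
    have := cat_rec m
    rw [div_eq_div_iff (cat_pos _).ne' (by positivity)]
    linarith
  simp_rw [e]
  have e2 : ∀ m : ℕ, ((m:ℝ)+2)/(2*(2*m+1)) = 1/4 + (3/4) * (1/(2*m+1)) := by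
    intro m
    have : (2*(m:ℝ)+1) ≠ 0 := by positivity
    field_simp
    ring
  simp_rw [e2]
  have h : Tendsto (fun m : ℕ => 1/(2*(m:ℝ)+1)) atTop (𝓝 0) := by
    have h1 := (tendsto_one_div_add_atTop_nhds_zero_nat (𝕜 := ℝ)).comp
      (tendsto_id.const_mul_atTop' (r := 2) (by norm_num) : Tendsto (fun m : ℕ => 2 * m) atTop atTop)
    refine h1.congr fun m => ?_
    simp
  have h5 := (h.const_mul (3/4)).const_add (1/4)
  rwa [mul_zero, add_zero] at h5

lemma Sm_cat (γ r : ℝ) (hr : 0 < r) (h : |γ| * r < 1) : Sm r (catS γ) := by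
  refine Summable.of_nonneg_of_le (fun k => norm_nonneg _) (fun k => ?_)
    (summable_geometric_of_lt_one (by positivity) h)
  simp only [catS, PowerSeries.coeff_mk]
  rw [norm_mul, norm_mul, norm_pow, norm_pow, Real.norm_eq_abs, Real.norm_eq_abs, Real.norm_eq_abs,
    abs_of_pos (cat_pos k), abs_div, abs_of_pos hr, abs_of_pos (by norm_num : (0:ℝ) < 4), mul_pow, div_pow]
  have := cat_le k
  have h3 : (catalan k : ℝ) / 4^k ≤ 1 := by rw [div_le_one (by positivity)]; exact this
  have h4 : 0 ≤ |γ|^k * r^k := by positivity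
  calc _ = ((catalan k : ℝ) / 4^k) * (|γ|^k * r^k) := by ring
    _ ≤ 1 * (|γ|^k * r^k) := by gcongr
    _ = _ := one_mul _

theorem analysis (n : ℕ) (hn : 1 ≤ n) (B S : PowerSeries ℝ)
    (hB : B = PowerSeries.C (2*(n:ℝ)) * PowerSeries.X + PowerSeries.X * (B * S))
    (hS : S = B + B * S) (hpos : ∀ m, 0 ≤ PowerSeries.coeff m B) :
    ∃ ρ : ℝ, 0 < ρ ∧ (∀ᶠ m in atTop, 0 < PowerSeries.coeff m B) ∧
      Tendsto (fun m => PowerSeries.coeff m B / PowerSeries.coeff (m+1) B) atTop (𝓝 ρ) ∧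
      Sm ρ B ∧ Sm ρ S ∧ ρ * (ev ρ S + ev ρ B) + ev ρ B = 1 := by
  have hn0 : (1:ℝ) ≤ n := by exact_mod_cast hn
  set q : ℝ := Real.sqrt (8*n) with hq
  have hq2 : q^2 = 8*n := Real.sq_sqrt (by positivity)
  have hq0 : 0 < q := Real.sqrt_pos.2 (by positivity)
  set α : ℝ := 2*n + q with hα
  set β : ℝ := 2*n - q with hβ
  have hα1 : 1 < α := by linarith
  have hβα : |β| < α := by rw [abs_lt]; constructor <;> linarith
  have hsum : α + β = 4*n := by rw [hα, hβ]; ring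
  have hprod : α * β = 4*n^2 - 8*n := by rw [hα, hβ]; linear_combination -hq2
  have hα0 : 0 < α := by linarith
  clear_value α β
  have hquad : B * (1 - B) = PowerSeries.C (2*(n:ℝ)) * PowerSeries.X * (1 - B)
      + PowerSeries.X * (B * B) := by
    linear_combination (1-B) * hB + PowerSeries.X * B * hS
  have hc2 : PowerSeries.C (2*(n:ℝ)) = 2 * PowerSeries.C (n:ℝ) := by
    rw [map_mul]; congr 1
  have hb0 : PowerSeries.constantCoeff B = 0 := by
    rw [hB]; simp
  -- factorization
  have hD : 1 + PowerSeries.C (2*(n:ℝ)) * PowerSeries.X - 2 * (1 + PowerSeries.X) * B = sqS α * sqS β := by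
    have hsq : (1 + PowerSeries.C (2*(n:ℝ)) * PowerSeries.X - 2 * (1 + PowerSeries.X) * B)^2
        = (sqS α * sqS β)^2 := by
      have h1 : (sqS α * sqS β)^2 = (1 - PowerSeries.C α * PowerSeries.X) * (1 - PowerSeries.C β * PowerSeries.X) := by
        rw [← sqS_sq, ← sqS_sq]; ring
      have h2 : PowerSeries.C α + PowerSeries.C β = 4 * PowerSeries.C (n:ℝ) := by
        rw [← map_add, hsum, map_mul]; congr 1
      have h3 : PowerSeries.C α * PowerSeries.C β = 4 * PowerSeries.C (n:ℝ)^2 - 8 * PowerSeries.C (n:ℝ) := by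
        rw [← map_mul, hprod, map_sub, map_mul, map_mul, map_pow]
        congr 2
      rw [h1]
      rw [hc2] at hquad ⊢
      linear_combination PowerSeries.X * h2 - PowerSeries.X^2 * h3 
        - 4 * (1+PowerSeries.X) * hquad
    rcases sq_eq_sq_iff_eq_or_eq_neg.1 hsq with h | h
    · exact h
    · exfalso
      have := congrArg PowerSeries.constantCoeff h
      simp [sqS, hb0] at this
      norm_num at this
  set E : PowerSeries ℝ := PowerSeries.mk fun k => (-1:ℝ)^k with hE
  have hE1 : (1 + PowerSeries.X) * E = 1 := by
    ext m
    cases m with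
    | zero => simp [hE]
    | succ m =>
      rw [add_mul, one_mul, map_add, PowerSeries.coeff_succ_X_mul]
      simp [hE, PowerSeries.coeff_one, pow_succ]
  obtain ⟨r, hr0, hr1, hrβ, hrα⟩ : ∃ r : ℝ, 0 < r ∧ r < 1 ∧ |β| * r < 1 ∧ 1/α < r := by
    have h1 : 0 ≤ |β| := abs_nonneg _
    set γ := max 1 |β| with hγ
    have g1 : 1 ≤ γ := le_max_left _ _
    have g2 : |β| ≤ γ := le_max_right _ _
    have g3 : γ < α := max_lt hα1 hβα
    refine ⟨2/(α+γ), by positivity, ?_, ?_, ?_⟩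
    · rw [div_lt_one (by positivity)]; linarith
    · rw [mul_div_assoc', div_lt_one (by positivity)]; linarith
    · rw [div_lt_div_iff₀ hα0 (by positivity)]; linarith
  set ρ : ℝ := 1/α with hρ
  have hρ0 : 0 < ρ := by positivity
  have hρ1 : ρ < 1 := hrα.trans hr1
  have hρβ : |β| * ρ < 1 := lt_of_le_of_lt (by gcongr) hrβ
  have SmE : ∀ x : ℝ, 0 < x → x < 1 → Sm x E := by
    intro x hx hx1
    refine (summable_geometric_of_lt_one hx.le hx1).congr fun k => ?_
    simp [hE, abs_of_pos hx]
  have Smsq : ∀ x : ℝ, 0 < x → |β| * x < 1 → Sm x (sqS β) := fun x hx h =>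
    (Sm_one x).sub (((Sm_C x _).mul (Sm_X x)).mul (Sm_cat β x hx h))
  set H := sqS β * E with hH
  set G := (1 + PowerSeries.C (2*(n:ℝ)) * PowerSeries.X - sqS β) * E with hG
  have SmH : Sm r H := (Smsq r hr0 hrβ).mul (SmE r hr0 hr1)
  have SmH' : Sm ρ H := (Smsq ρ hρ0 hρβ).mul (SmE ρ hρ0 hρ1)
  have SmG : Sm r G := (((Sm_one r).add ((Sm_C r _).mul (Sm_X r))).sub (Smsq r hr0 hrβ)).mul (SmE r hr0 hr1)
  have hBG : 2 * B = G + PowerSeries.C (α/2) * (PowerSeries.X * (catS α * H)) := by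
    have : 2 * B = 2 * ((1+PowerSeries.X) * E) * B := by rw [hE1]; ring
    rw [this, hG, hH]
    have h2 : sqS α = 1 - PowerSeries.C (α/2) * PowerSeries.X * catS α := rfl
    rw [h2] at hD
    linear_combination (-E) * hD
  set a : ℕ → ℝ := fun k => (catalan k : ℝ) * (α/4)^k with ha
  have apos : ∀ m, 0 < a m := fun m => mul_pos (cat_pos m) (by positivity)
  have arat : Tendsto (fun m => a m / a (m+1)) atTop (𝓝 ρ) := by
    have h1 := cat_ratio.mul_const (4/α)
    rw [show (1:ℝ)/4 * (4/α) = ρ by rw [hρ]; field_simp] at h1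
    refine h1.congr fun m => ?_
    have := (cat_pos (m+1)).ne'
    simp only [ha]
    rw [pow_succ]
    field_simp
  have T := tannery a (fun k => PowerSeries.coeff k H) ρ r hρ0 hrα apos arat SmH
  have T2 : Tendsto (fun m => PowerSeries.coeff (m+1) G / a m) atTop (𝓝 0) := by
    obtain ⟨C, hC, hb⟩ := dom_bound a ρ r hρ0 hrα apos arat
    have h0 : Tendsto (fun k => ‖PowerSeries.coeff k G * r^k‖) atTop (𝓝 0) :=
      Summable.tendsto_atTop_zero SmG
    have h1 := ((tendsto_add_atTop_iff_nat 1).2 h0).const_mul (C/(a 0 * r))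
    rw [mul_zero] at h1
    refine squeeze_zero_norm (fun m => ?_) h1
    have h2 := hb 0 m
    rw [zero_add] at h2
    rw [norm_div, norm_mul (PowerSeries.coeff (m+1) G), Real.norm_of_nonneg (apos m).le, Real.norm_of_nonneg (pow_pos hr0 _).le,
      div_le_iff₀ (apos m), pow_succ]
    have h3 := apos 0
    have h4 : 1 ≤ C * r^m * a m / a 0 := by rwa [one_le_div h3]
    calc ‖PowerSeries.coeff (m+1) G‖ = ‖PowerSeries.coeff (m+1) G‖ * 1 := (mul_one _).symm
      _ ≤ ‖PowerSeries.coeff (m+1) G‖ * (C * r^m * a m / a 0) := by gcongr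
      _ = _ := by field_simp
  set Lm : ℝ := α/4 * ev ρ H with hLm
  have T3 : Tendsto (fun m => PowerSeries.coeff (m+1) B / a m) atTop (𝓝 Lm) := by
    have h1 := (T2.const_mul (1/2)).add (T.const_mul (α/4))
    rw [mul_zero, zero_add] at h1
    refine h1.congr fun m => ?_
    have h2 := congrArg (PowerSeries.coeff (m+1)) hBG
    rw [map_add, PowerSeries.coeff_C_mul, PowerSeries.coeff_succ_X_mul, PowerSeries.coeff_mul m (catS α) H,
      show (2:PowerSeries ℝ) = PowerSeries.C 2 from (map_ofNat _ 2).symm, PowerSeries.coeff_C_mul] at h2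
    have h3 : ∀ k, PowerSeries.coeff k (catS α) = a k := fun k => by simp [catS, ha]
    simp_rw [h3] at h2
    have h4 := (apos m).ne'
    field_simp
    linarith
  have hL0 : 0 < Lm := by
    have h1 : 0 ≤ Lm := ge_of_tendsto' T3 fun m => div_nonneg (hpos _) (apos m).le
    refine lt_of_le_of_ne h1 fun h => ?_
    have h2 : ev ρ H = 0 := by
      have : α/4 ≠ 0 := by positivity
      rcases mul_eq_zero.1 h.symm with h | h
      · exact absurd h this
      · exact h
    have h3 : ((1+PowerSeries.X) * (1 + PowerSeries.X)) * (H * H) = 1 - PowerSeries.C β * PowerSeries.X := by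
      rw [← sqS_sq, hH]
      linear_combination (sqS β * sqS β * ((1+PowerSeries.X)*E + 1)) * hE1
    have h4 := congrArg (ev ρ) h3
    have s1 := (Sm_one ρ).add (Sm_X ρ)
    rw [ev_mul (s1.mul s1) (SmH'.mul SmH'), ev_mul SmH' SmH', h2, 
      ev_sub (Sm_one ρ) ((Sm_C ρ _).mul (Sm_X ρ)), ev_mul (Sm_C ρ _) (Sm_X ρ), ev_one, ev_C, ev_X] at h4
    have h5 : β * ρ ≤ |β| * ρ := by gcongr; exact le_abs_self β
    linarith
  have bpos : ∀ᶠ m in atTop, 0 < PowerSeries.coeff m B := by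
    have h1 := T3.eventually (lt_mem_nhds hL0)
    rw [eventually_atTop] at h1 ⊢
    obtain ⟨N, h1⟩ := h1
    refine ⟨N+1, fun m hm => ?_⟩
    have := h1 (m-1) (by omega)
    rw [Nat.sub_add_cancel (by omega)] at this
    exact (div_pos_iff_of_pos_right (apos _)).1 this
  have brat : Tendsto (fun m => PowerSeries.coeff m B / PowerSeries.coeff (m+1) B) atTop (𝓝 ρ) := by
    rw [← tendsto_add_atTop_iff_nat 1]
    have h1 := (T3.mul arat).div ((tendsto_add_atTop_iff_nat 1).2 T3) hL0.ne'
    rw [mul_div_cancel_left₀ _ hL0.ne'] at h1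
    refine h1.congr fun m => ?_
    simp only [Pi.div_apply]
    have := (apos m).ne'
    have := (apos (m+1)).ne'
    field_simp
  have SmB : Sm ρ B := by
    unfold Sm
    rw [← summable_nat_add_iff 1]
    refine summable_of_isBigO_nat (g := fun m => (catalan m : ℝ)/4^m) cat_summable ?_
    have h1 : (fun m => PowerSeries.coeff (m+1) B / a m) =O[atTop] (fun _ => (1:ℝ)) := T3.isBigO_one ℝ
    have h2 := h1.mul (Asymptotics.isBigO_refl (fun m => a m * ρ^(m+1)) atTop)
    have h3 : (fun m => (1:ℝ) * (a m * ρ^(m+1))) =O[atTop] (fun m => (catalan m : ℝ)/4^m) := by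
      have : (fun m => (1:ℝ) * (a m * ρ^(m+1))) = fun m => ρ * ((catalan m : ℝ)/4^m) := by
        funext m
        simp only [ha, hρ]
        rw [pow_succ, div_pow, div_pow]
        field_simp
        simp
      rw [this]
      exact (Asymptotics.isBigO_refl _ _).const_mul_left ρ
    refine Asymptotics.IsBigO.norm_left ((h2.trans h3).congr_left fun m => ?_)
    have := (apos m).ne'
    field_simp
  have hXS : PowerSeries.X * S = (PowerSeries.X * B + B) - PowerSeries.C (2*(n:ℝ)) * PowerSeries.X := by
    linear_combination PowerSeries.X * hS - hB
  have SmXS : Sm ρ (PowerSeries.X * S) := by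
    rw [hXS]
    exact (((Sm_X ρ).mul SmB).add SmB).sub ((Sm_C ρ _).mul (Sm_X ρ))
  have SmS : Sm ρ S := by
    unfold Sm at SmXS
    rw [← summable_nat_add_iff 1] at SmXS
    have h2 := SmXS.mul_left (1/ρ)
    refine h2.congr fun m => ?_
    rw [PowerSeries.coeff_succ_X_mul, pow_succ, ← mul_assoc, norm_mul _ ρ, Real.norm_of_nonneg hρ0.le]
    field_simp
  refine ⟨ρ, hρ0, bpos, brat, SmB, SmS, ?_⟩
  have e1 := congrArg (ev ρ) hB
  have e2 := congrArg (ev ρ) hS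
  rw [ev_add ((Sm_C ρ _).mul (Sm_X ρ)) ((Sm_X ρ).mul (SmB.mul SmS)), ev_mul (Sm_C ρ _) (Sm_X ρ),
    ev_mul (Sm_X ρ) (SmB.mul SmS), ev_mul SmB SmS, ev_C, ev_X] at e1
  rw [ev_add SmB (SmB.mul SmS), ev_mul SmB SmS] at e2
  set τ := ev ρ B
  set σ := ev ρ S
  have hαρ : α * ρ = 1 := by rw [hρ]; field_simp
  have hdisc : 1 - 4*n*ρ + (4*n^2 - 8*n)*ρ^2 = 0 := by
    rw [← hsum, ← hprod]
    linear_combination (-1 + β * ρ) * hαρ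
  have h4 : (2*(1+ρ)*τ - (1+2*n*ρ))^2 = 0 := by
    have h5 : τ * (1-τ) = 2*n*ρ*(1-τ) + ρ*(τ*τ) := by
      linear_combination (1-τ)*e1 + ρ*τ*e2
    linear_combination hdisc - 4*(1+ρ)*h5
  have h6 : 2*(1+ρ)*τ - (1+2*n*ρ) = 0 := by simpa using h4
  linear_combination h6 + ρ * e2 - e1

def OscLe (x : ℕ → ℝ) (d : ℝ) : Prop :=
  ∀ ε > 0, ∃ N, ∀ m ≥ N, ∀ m' ≥ N, |x m - x m'| ≤ d + ε

lemma OscLe.add {x y : ℕ → ℝ} {d e : ℝ} (hx : OscLe x d) (hy : OscLe y e) :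
    OscLe (fun m => x m + y m) (d + e) := by
  intro ε hε
  obtain ⟨N, hN⟩ := hx (ε/2) (by positivity)
  obtain ⟨N', hN'⟩ := hy (ε/2) (by positivity)
  refine ⟨max N N', fun m hm m' hm' => ?_⟩
  have h1 := hN m (le_of_max_le_left hm) m' (le_of_max_le_left hm')
  have h2 := hN' m (le_of_max_le_right hm) m' (le_of_max_le_right hm')
  rw [abs_le] at *
  constructor <;> linarith

lemma OscLe.mono {x : ℕ → ℝ} {d e : ℝ} (hx : OscLe x d) (h : d ≤ e) : OscLe x e := by
  intro ε hε
  obtain ⟨N, hN⟩ := hx ε hε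
  exact ⟨N, fun m hm m' hm' => (hN m hm m' hm').trans (by linarith)⟩

lemma OscLe.of_eps {x : ℕ → ℝ} {d : ℝ} (h : ∀ ε > 0, OscLe x (d + ε)) : OscLe x d := by
  intro ε hε
  obtain ⟨N, hN⟩ := h (ε/2) (by positivity) (ε/2) (by positivity)
  exact ⟨N, fun m hm m' hm' => (hN m hm m' hm').trans (by linarith)⟩

lemma OscLe.of_tendsto {x : ℕ → ℝ} {a : ℝ} (h : Tendsto x atTop (𝓝 a)) : OscLe x 0 := by
  intro ε hε
  obtain ⟨N, hN⟩ := Metric.cauchySeq_iff.1 h.cauchySeq ε hε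
  refine ⟨N, fun m hm m' hm' => ?_⟩
  have := hN m hm m' hm'
  rw [Real.dist_eq] at this
  linarith

lemma OscLe.zero : OscLe (fun _ => 0) 0 := OscLe.of_tendsto tendsto_const_nhds

lemma OscLe.tendsto {x : ℕ → ℝ} (h : OscLe x 0) : ∃ a, Tendsto x atTop (𝓝 a) := by
  apply cauchySeq_tendsto_of_complete
  rw [Metric.cauchySeq_iff]
  intro ε hε
  obtain ⟨N, hN⟩ := h (ε/2) (by positivity)
  refine ⟨N, fun m hm m' hm' => ?_⟩
  have := hN m hm m' hm'
  rw [Real.dist_eq]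
  linarith

lemma OscLe.congr {x y : ℕ → ℝ} {d : ℝ} (hx : OscLe x d) (h : ∀ᶠ m in atTop, x m = y m) :
    OscLe y d := by
  intro ε hε
  obtain ⟨N, hN⟩ := hx ε hε
  obtain ⟨N', hN'⟩ := eventually_atTop.1 h
  refine ⟨max N N', fun m hm m' hm' => ?_⟩
  rw [← hN' m (le_of_max_le_right hm), ← hN' m' (le_of_max_le_right hm')]
  exact hN m (le_of_max_le_left hm) m' (le_of_max_le_left hm')

lemma OscLe.sum {ι : Type*} (t : Finset ι) {x : ι → ℕ → ℝ} {d : ι → ℝ}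
    (h : ∀ i ∈ t, OscLe (x i) (d i)) : OscLe (fun m => ∑ i ∈ t, x i m) (∑ i ∈ t, d i) := by
  classical
  induction t using Finset.induction_on with
  | empty => simpa using OscLe.zero
  | insert a t ha ih =>
    simp_rw [Finset.sum_insert ha]
    exact (h a (Finset.mem_insert_self _ _)).add (ih fun i hi => h i (Finset.mem_insert_of_mem hi))

lemma OscLe.const_mul {x : ℕ → ℝ} {d c : ℝ} (hc : 0 ≤ c) (hx : OscLe x d) :
    OscLe (fun m => c * x m) (c * d) := by
  intro ε hε
  obtain ⟨N, hN⟩ := hx (ε/(c+1)) (by positivity)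
  refine ⟨N, fun m hm m' hm' => ?_⟩
  rw [← mul_sub, abs_mul, abs_of_nonneg hc]
  have h1 := mul_le_mul_of_nonneg_left (hN m hm m' hm') hc
  have h2 : c * (ε/(c+1)) ≤ ε := by
    rw [mul_div_assoc', div_le_iff₀ (by positivity)]
    nlinarith
  linarith

lemma OscLe.of_bdd {x : ℕ → ℝ} {M : ℝ} (h : ∀ᶠ m in atTop, 0 ≤ x m ∧ x m ≤ M) : OscLe x M := by
  intro ε hε
  obtain ⟨N, hN⟩ := eventually_atTop.1 h
  refine ⟨N, fun m hm m' hm' => ?_⟩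
  have h1 := hN m hm
  have h2 := hN m' hm'
  rw [abs_le]
  constructor <;> linarith

lemma OscLe.shift {x : ℕ → ℝ} {d : ℝ} (k : ℕ) (h : OscLe (fun m => x (m+k)) d) : OscLe x d := by
  intro ε hε
  obtain ⟨N, hN⟩ := h ε hε
  refine ⟨N+k, fun m hm m' hm' => ?_⟩
  have := hN (m-k) (by omega) (m'-k) (by omega)
  simpa [Nat.sub_add_cancel (show k ≤ m by omega), Nat.sub_add_cancel (show k ≤ m' by omega)] using this

lemma OscLe.mul_tendsto {x z : ℕ → ℝ} {d ζ M : ℝ} (hx : OscLe x d) (hz : Tendsto z atTop (𝓝 ζ))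
    (hζ : 0 ≤ ζ) (hM : ∀ᶠ m in atTop, |x m| ≤ M) : OscLe (fun m => x m * z m) (ζ * d) := by
  have h1 : Tendsto (fun m => x m * (z m - ζ)) atTop (𝓝 0) := by
    have h2 : Tendsto (fun m => z m - ζ) atTop (𝓝 0) := by
      simpa using hz.sub_const ζ
    have h3 : Tendsto (fun m => M * |z m - ζ|) atTop (𝓝 0) := by
      simpa using h2.abs.const_mul M
    refine squeeze_zero_norm' ?_ h3
    filter_upwards [hM] with m hm
    rw [norm_mul, Real.norm_eq_abs, Real.norm_eq_abs]
    gcongr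
  have h4 := (hx.const_mul hζ).add (OscLe.of_tendsto h1)
  rw [add_zero] at h4
  exact h4.congr (Eventually.of_forall fun m => by ring)

/-- convolution -/
def cv (u v : ℕ → ℝ) (m : ℕ) : ℝ := ∑ p ∈ Finset.HasAntidiagonal.antidiagonal m, u p.1 * v p.2

def midS (K : ℕ) (u v : ℕ → ℝ) (m : ℕ) : ℝ := ∑ i ∈ Finset.Ico K (m+1-K), u i * v (m-i)

lemma cv_split (u v : ℕ → ℝ) (K m : ℕ) (h : 2*K ≤ m) :
    cv u v m = (∑ j ∈ Finset.range K, v j * u (m-j)) + (∑ i ∈ Finset.range K, u i * v (m-i))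
      + midS K u v m := by
  have h1 : ∑ i ∈ Finset.Ico (m+1-K) (m+1), u i * v (m-i) = ∑ j ∈ Finset.range K, v j * u (m-j) := by
    refine Finset.sum_nbij' (fun i => m - i) (fun j => m - j) ?_ ?_ ?_ ?_ ?_
    · intro i hi; simp at hi ⊢; omega
    · intro i hi; simp at hi ⊢; omega
    · intro i hi; simp at hi ⊢; omega
    · intro i hi; simp at hi ⊢; omega
    · intro i hi; simp at hi ⊢
      rw [show m - (m-i) = i by omega]; ring
  unfold cv midS
  rw [Finset.Nat.sum_antidiagonal_eq_sum_range_succ_mk, ← h1, Finset.range_eq_Ico, Finset.range_eq_Ico,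
    ← Finset.sum_Ico_consecutive _ (Nat.zero_le K) (show K ≤ m+1 by omega),
    ← Finset.sum_Ico_consecutive _ (show K ≤ m+1-K by omega) (show m+1-K ≤ m+1 by omega)]
  ring

structure Crit (b s : ℕ → ℝ) (ρ : ℝ) : Prop where
  b0 : ∀ m, 0 ≤ b m
  s0 : ∀ m, 0 ≤ s m
  ρ0 : 0 < ρ
  bpos : ∀ᶠ m in atTop, 0 < b m
  rat : Tendsto (fun m => b m / b (m+1)) atTop (𝓝 ρ)
  sb : Summable fun m => b m * ρ^m
  ss : Summable fun m => s m * ρ^m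
  hw : ∀ᶠ m in atTop, cv b s m = b (m+1)
  hs : ∀ m, s m = b m + cv b s m
  crit : ρ * ((∑' m, s m * ρ^m) + ∑' m, b m * ρ^m) + (∑' m, b m * ρ^m) = 1

section
variable {b s : ℕ → ℝ} {ρ : ℝ}

lemma Crit.w_lim (h : Crit b s ρ) : Tendsto (fun m => cv b s m / b m) atTop (𝓝 (1/ρ)) := by
  have h1 := h.rat.inv₀ h.ρ0.ne'
  rw [← one_div] at h1
  refine h1.congr' ?_
  filter_upwards [h.hw] with m hm
  rw [hm, inv_div]

lemma Crit.s_lim (h : Crit b s ρ) : Tendsto (fun m => s m / b m) atTop (𝓝 (1 + 1/ρ)) := by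
  refine (h.w_lim.const_add 1).congr' ?_
  filter_upwards [h.bpos] with m hm
  rw [h.hs m, add_div, div_self hm.ne']

lemma shift_lim (h : Crit b s ρ) (u : ℕ → ℝ) (L : ℝ) (hu : Tendsto (fun m => u m / b m) atTop (𝓝 L)) (j : ℕ) :
    Tendsto (fun m => u (m-j) / b m) atTop (𝓝 (L * ρ^j)) := by
  rw [← tendsto_add_atTop_iff_nat j]
  refine (hu.mul (ratio_pow b ρ h.bpos h.rat j)).congr' ?_
  filter_upwards [h.bpos] with m hm
  rw [Nat.add_sub_cancel, div_mul_div_cancel₀ hm.ne']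

lemma b_lim (h : Crit b s ρ) : Tendsto (fun m => b m / b m) atTop (𝓝 1) := by
  refine tendsto_const_nhds.congr' ?_
  filter_upwards [h.bpos] with m hm
  rw [div_self hm.ne']

lemma bigjump (h : Crit b s ρ) (ε : ℝ) (hε : 0 < ε) :
    ∃ K, ∀ᶠ m in atTop, midS K b s m / b m ≤ ε := by
  have t1 := h.sb.hasSum.tendsto_sum_nat
  have t2 := h.ss.hasSum.tendsto_sum_nat
  have t3 := (t2.add (t1.mul_const (1+1/ρ))).const_sub (1/ρ)
  have e0 : 1/ρ - ((∑' m, s m * ρ^m) + (∑' m, b m * ρ^m) * (1 + 1/ρ)) = 0 := by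
    have := h.crit
    have := h.ρ0
    field_simp
    linarith
  rw [e0] at t3
  obtain ⟨K, hK⟩ := (t3.eventually (gt_mem_nhds hε)).exists
  refine ⟨K, ?_⟩
  have l1 : Tendsto (fun m => ∑ j ∈ Finset.range K, s j * (b (m-j) / b m)) atTop
      (𝓝 (∑ j ∈ Finset.range K, s j * (1 * ρ^j))) :=
    tendsto_finsetSum _ fun j _ => (shift_lim h b 1 (b_lim h) j).const_mul _
  have l2 : Tendsto (fun m => ∑ j ∈ Finset.range K, b j * (s (m-j) / b m)) atTop
      (𝓝 (∑ j ∈ Finset.range K, b j * ((1+1/ρ) * ρ^j))) :=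
    tendsto_finsetSum _ fun j _ => (shift_lim h s _ h.s_lim j).const_mul _
  have l3 := (h.w_lim.sub (l1.add l2))
  have e1 : (∑ j ∈ Finset.range K, s j * (1 * ρ^j)) + ∑ j ∈ Finset.range K, b j * ((1+1/ρ) * ρ^j)
      = (∑ j ∈ Finset.range K, s j * ρ^j) + (∑ j ∈ Finset.range K, b j * ρ^j) * (1+1/ρ) := by
    rw [Finset.sum_mul]
    congr 1
    · exact Finset.sum_congr rfl fun j _ => by ring
    · exact Finset.sum_congr rfl fun j _ => by ring
  rw [e1] at l3
  filter_upwards [l3.eventually (gt_mem_nhds hK), eventually_ge_atTop (2*K)] with m hm hm2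
  rw [cv_split b s K m hm2] at hm
  refine le_trans (le_of_eq ?_) hm.le
  rw [add_div, add_div, Finset.sum_div, Finset.sum_div]
  simp_rw [mul_div_assoc]
  ring

lemma shift_osc (h : Crit b s ρ) (u : ℕ → ℝ) (d M : ℝ) (hu0 : ∀ m, 0 ≤ u m)
    (hM : ∀ᶠ m in atTop, u m / b m ≤ M)
    (hu : OscLe (fun m => u m / b m) d) (j : ℕ) :
    OscLe (fun m => u (m-j) / b m) (ρ^j * d) := by
  apply OscLe.shift j
  have h1 := hu.mul_tendsto (ratio_pow b ρ h.bpos h.rat j) (pow_pos h.ρ0 j).le (M := M) (by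
    filter_upwards [hM] with m hm
    rwa [abs_of_nonneg (div_nonneg (hu0 m) (h.b0 m))])
  refine h1.congr ?_
  filter_upwards [h.bpos] with m hm
  rw [Nat.add_sub_cancel, div_mul_div_cancel₀ hm.ne']

lemma sum_osc (h : Crit b s ρ) (u v : ℕ → ℝ) (d M : ℝ) (hd : 0 ≤ d) (hu0 : ∀ m, 0 ≤ u m)
    (hv0 : ∀ m, 0 ≤ v m) (hv : Summable fun m => v m * ρ^m)
    (hM : ∀ᶠ m in atTop, u m / b m ≤ M)
    (hu : OscLe (fun m => u m / b m) d) (K : ℕ) :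
    OscLe (fun m => ∑ j ∈ Finset.range K, v j * (u (m-j) / b m)) (d * ∑' m, v m * ρ^m) := by
  have h1 := OscLe.sum (Finset.range K) (fun j _ => (shift_osc h u d M hu0 hM hu j).const_mul (hv0 j))
  refine h1.mono ?_
  calc ∑ j ∈ Finset.range K, v j * (ρ^j * d) = d * ∑ j ∈ Finset.range K, v j * ρ^j := by
        rw [Finset.mul_sum]; exact Finset.sum_congr rfl fun j _ => by ring
    _ ≤ _ := by
        gcongr
        exact hv.sum_le_tsum _ (fun j _ => mul_nonneg (hv0 j) (pow_pos h.ρ0 j).le)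

lemma Crit.s_bdd (h : Crit b s ρ) (v : ℕ → ℝ) (hvs : ∀ m, v m ≤ s m) :
    ∀ᶠ m in atTop, v m / b m ≤ 2 + 1/ρ := by
  filter_upwards [h.s_lim.eventually (gt_mem_nhds (show 1 + 1/ρ < 2 + 1/ρ by linarith))] with m hm
  exact le_trans (div_le_div_of_nonneg_right (hvs m) (h.b0 m)) hm.le

lemma Crit.b_le_s (h : Crit b s ρ) (m : ℕ) : b m ≤ s m := by
  rw [h.hs m]
  have : 0 ≤ cv b s m := Finset.sum_nonneg fun p _ => mul_nonneg (h.b0 _) (h.s0 _)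
  linarith

lemma conv_osc (h : Crit b s ρ) (u v : ℕ → ℝ) (d e : ℝ) (hd : 0 ≤ d) (he : 0 ≤ e)
    (hu0 : ∀ m, 0 ≤ u m) (hv0 : ∀ m, 0 ≤ v m) (hub : ∀ m, u m ≤ b m) (hvs : ∀ m, v m ≤ s m)
    (hu : OscLe (fun m => u m / b m) d) (hv : OscLe (fun m => v m / b m) e) :
    OscLe (fun m => cv u v m / b m) (d * (∑' m, v m * ρ^m) + e * ∑' m, u m * ρ^m) := by
  have su : Summable fun m => u m * ρ^m :=
    Summable.of_nonneg_of_le (fun m => mul_nonneg (hu0 m) (pow_pos h.ρ0 m).le)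
      (fun m => mul_le_mul_of_nonneg_right (hub m) (pow_pos h.ρ0 m).le) h.sb
  have sv : Summable fun m => v m * ρ^m :=
    Summable.of_nonneg_of_le (fun m => mul_nonneg (hv0 m) (pow_pos h.ρ0 m).le)
      (fun m => mul_le_mul_of_nonneg_right (hvs m) (pow_pos h.ρ0 m).le) h.ss
  refine OscLe.of_eps fun ε hε => ?_
  obtain ⟨K, hK⟩ := bigjump h ε hε
  have o1 := sum_osc h u v d _ hd hu0 hv0 sv (h.s_bdd u fun m => (hub m).trans (h.b_le_s m)) hu K
  have o2 := sum_osc h v u e _ he hv0 hu0 su (h.s_bdd v hvs) hv K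
  have o3 : OscLe (fun m => midS K u v m / b m) ε := by
    apply OscLe.of_bdd
    filter_upwards [hK] with m hm
    constructor
    · exact div_nonneg (Finset.sum_nonneg fun i _ => mul_nonneg (hu0 _) (hv0 _)) (h.b0 m)
    · refine le_trans (div_le_div_of_nonneg_right ?_ (h.b0 m)) hm
      exact Finset.sum_le_sum fun i _ => mul_le_mul (hub _) (hvs _) (hv0 _) (h.b0 _)
  refine ((o1.add o2).add o3).congr ?_
  filter_upwards [eventually_ge_atTop (2*K)] with m hm
  rw [cv_split u v K m hm, add_div, add_div, Finset.sum_div, Finset.sum_div]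
  simp_rw [mul_div_assoc]

end

structure Sys {F : Type} [Fintype F] [DecidableEq F] (n : ℕ) (op : Bool → F → F → F) (ab : Bool → F)
    (l : F → ℝ) (y w s : Bool → F → ℕ → ℝ) : Prop where
  hab : ∀ c g, op c g (ab c) = ab c
  hneu : ∀ c h, op c (ab (!c)) h = h
  y0 : ∀ c f m, 0 ≤ y c f m
  w0 : ∀ c f m, 0 ≤ w c f m
  hs : ∀ c f m, s c f m = y c f m + w c f m
  hyz : ∀ c f, y c f 0 = 0
  hy : ∀ c f m, y c f (m+1) = (if m = 0 then l f else 0) + w (!c) f m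
  hw : ∀ c f m, w c f m = ∑ g, ∑ h, if op c g h = f then cv (y c g) (s c h) m else 0
  hl : ∑ f, l f = 2 * n
  hex : ∀ c h, ∃ j, 0 < s c h j

section
variable {F : Type} [Fintype F] [DecidableEq F] {n : ℕ} {op : Bool → F → F → F} {ab : Bool → F}
    {l : F → ℝ} {y w s : Bool → F → ℕ → ℝ}

lemma Sys.s0 (h : Sys n op ab l y w s) (c f m) : 0 ≤ s c f m := by
  rw [h.hs]; exact add_nonneg (h.y0 _ _ _) (h.w0 _ _ _)

lemma cv_sum_left {ι : Type*} (t : Finset ι) (u : ι → ℕ → ℝ) (v : ℕ → ℝ) (m : ℕ) :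
    cv (fun k => ∑ i ∈ t, u i k) v m = ∑ i ∈ t, cv (u i) v m := by
  unfold cv
  rw [Finset.sum_comm]
  exact Finset.sum_congr rfl fun p _ => by rw [Finset.sum_mul]

lemma cv_sum_right {ι : Type*} (t : Finset ι) (u : ℕ → ℝ) (v : ι → ℕ → ℝ) (m : ℕ) :
    cv u (fun k => ∑ i ∈ t, v i k) m = ∑ i ∈ t, cv u (v i) m := by
  unfold cv
  rw [Finset.sum_comm]
  exact Finset.sum_congr rfl fun p _ => by rw [Finset.mul_sum]

lemma Sys.wtot (h : Sys n op ab l y w s) (c m) :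
    ∑ f, w c f m = cv (fun k => ∑ f, y c f k) (fun k => ∑ f, s c f k) m := by
  simp_rw [h.hw]
  rw [Finset.sum_comm, cv_sum_left]
  refine Finset.sum_congr rfl fun g _ => ?_
  rw [Finset.sum_comm, cv_sum_right]
  refine Finset.sum_congr rfl fun k _ => ?_
  simp

lemma Sys.ytot (h : Sys n op ab l y w s) (c m) :
    ∑ f, y c f (m+1) = (if m = 0 then 2 * (n:ℝ) else 0) + ∑ f, w (!c) f m := by
  simp_rw [h.hy, Finset.sum_add_distrib]
  congr 1
  split_ifs
  · exact h.hl
  · simp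

lemma Sys.stot (h : Sys n op ab l y w s) (c m) :
    ∑ f, s c f m = ∑ f, y c f m + ∑ f, w c f m := by
  simp_rw [h.hs, Finset.sum_add_distrib]

lemma Sys.symm (h : Sys n op ab l y w s) (m : ℕ) : ∀ k ≤ m, 
    (∑ f, y true f k = ∑ f, y false f k) ∧ (∑ f, s true f k = ∑ f, s false f k) ∧ 
    (∑ f, w true f k = ∑ f, w false f k) := by
  induction m with
  | zero =>
    intro k hk
    obtain rfl : k = 0 := by omega
    have e : ∀ c, ∑ f, w c f 0 = 0 := by
      intro c; rw [h.wtot]; simp [cv, h.hyz]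
    simp [h.stot, h.hyz, e]
  | succ m ih =>
    intro k hk
    rcases Nat.lt_or_ge k (m+1) with hk1 | hk1
    · exact ih k (by omega)
    · obtain rfl : k = m+1 := by omega
      have e1 : ∑ f, y true f (m+1) = ∑ f, y false f (m+1) := by
        rw [h.ytot, h.ytot]
        simp [(ih m le_rfl).2.2]
      have e2 : ∑ f, w true f (m+1) = ∑ f, w false f (m+1) := by
        rw [h.wtot, h.wtot]
        unfold cv
        refine Finset.sum_congr rfl fun p hp => ?_
        have hp := Finset.HasAntidiagonal.mem_antidiagonal.1 hp
        beta_reduce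
        rcases Nat.eq_zero_or_pos p.1 with h0 | h0
        · simp [h0, h.hyz]
        · rw [(ih p.2 (by omega)).2.1]
          congr 1
          rcases Nat.lt_or_ge p.1 (m+1) with h1 | h1
          · exact (ih p.1 (by omega)).1
          · rw [show p.1 = m+1 by omega, e1]
      refine ⟨e1, ?_, e2⟩
      rw [h.stot, h.stot, e1, e2]

lemma Sys.crit (h : Sys n op ab l y w s) (hn : 1 ≤ n) :
    ∃ ρ b st, Crit b st ρ ∧ (∀ c m, ∑ f, y c f m = b m) ∧ (∀ c m, ∑ f, s c f m = st m) := by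
  set b : ℕ → ℝ := fun k => ∑ f, y true f k with hb
  set st : ℕ → ℝ := fun k => ∑ f, s true f k with hst
  have hyb : ∀ c m, ∑ f, y c f m = b m := by
    intro c m; cases c
    · exact ((h.symm m m le_rfl).1).symm
    · rfl
  have hss : ∀ c m, ∑ f, s c f m = st m := by
    intro c m; cases c
    · exact ((h.symm m m le_rfl).2.1).symm
    · rfl
  have hwt : ∀ c m, ∑ f, w c f m = cv b st m := by
    intro c m; rw [h.wtot]; simp_rw [hyb, hss]
  have hb1 : ∀ m, b (m+1) = (if m = 0 then 2 * (n:ℝ) else 0) + cv b st m := by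
    intro m
    have := h.ytot true m
    rw [hwt, hyb] at this
    exact this
  have hst1 : ∀ m, st m = b m + cv b st m := by
    intro m
    rw [← hss true m, h.stot, hwt, hyb]
  have hbz : b 0 = 0 := by simp [hb, h.hyz]
  have b0 : ∀ m, 0 ≤ b m := fun m => Finset.sum_nonneg fun f _ => h.y0 _ _ _
  have s0 : ∀ m, 0 ≤ st m := fun m => Finset.sum_nonneg fun f _ => h.s0 _ _ _
  have hcoe : ∀ m, PowerSeries.coeff m (PowerSeries.mk b * PowerSeries.mk st) = cv b st m := by
    intro m; rw [PowerSeries.coeff_mul]; simp [cv]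
  obtain ⟨ρ, hρ, bpos, rat, sb, ss, crit⟩ := analysis n hn (PowerSeries.mk b) (PowerSeries.mk st)
    (by
      ext m
      cases m with
      | zero => simp [hbz]
      | succ m =>
        rw [map_add, PowerSeries.coeff_C_mul, PowerSeries.coeff_succ_X_mul, hcoe, PowerSeries.coeff_mk, hb1,
          PowerSeries.coeff_X]
        congr 1
        simp)
    (by
      ext m
      rw [map_add, hcoe, PowerSeries.coeff_mk, PowerSeries.coeff_mk, hst1])
    (fun m => by simpa using b0 m)
  simp only [PowerSeries.coeff_mk, Sm, ev] at *
  refine ⟨ρ, b, st, ⟨b0, s0, hρ, bpos, rat, sb.of_norm, ss.of_norm, ?_, hst1, crit⟩, hyb, hss⟩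
  filter_upwards [eventually_ge_atTop 1] with m hm
  rw [hb1, if_neg (by omega), zero_add]

lemma Sys.w_decomp (h : Sys n op ab l y w s) (b : ℕ → ℝ) (hyb : ∀ c m, ∑ f, y c f m = b m) (c f m) :
    w c f m = ∑ k, if k = ab c then (if f = ab c then cv b (s c k) m else 0) else
      ∑ g, if op c g k = f then cv (y c g) (s c k) m else 0 := by
  rw [h.hw, Finset.sum_comm]
  refine Finset.sum_congr rfl fun k _ => ?_
  split_ifs with h1 h2
  · subst h1; subst h2
    simp_rw [h.hab, if_true]
    rw [← cv_sum_left]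
    congr 1
    funext k; exact hyb c k
  · subst h1
    simp_rw [h.hab]
    exact Finset.sum_eq_zero fun g _ => if_neg fun h => h2 h.symm
  · rfl

theorem Sys.step (h : Sys n op ab l y w s) (ρ : ℝ) (b st : ℕ → ℝ) (hc : Crit b st ρ)
    (hyb : ∀ c m, ∑ f, y c f m = b m) (hss : ∀ c m, ∑ f, s c f m = st m) :
    ∃ θ : ℝ, 0 ≤ θ ∧ θ < 1 ∧ ∀ D : ℝ, 
      (∃ d : Bool → F → ℝ, (∀ c f, 0 ≤ d c f) ∧ (∀ c f, OscLe (fun m => w c f m / b m) (d c f)) ∧ 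
        ∀ c, ∑ f, d c f ≤ D) → 
      (∃ d : Bool → F → ℝ, (∀ c f, 0 ≤ d c f) ∧ (∀ c f, OscLe (fun m => w c f m / b m) (d c f)) ∧ 
        ∀ c, ∑ f, d c f ≤ θ * D) := by
  have hρ := hc.ρ0
  have yb : ∀ c f m, y c f m ≤ b m := fun c f m => by
    rw [← hyb c]; exact Finset.single_le_sum (f := fun f => y c f m) (fun f _ => h.y0 c f m) (Finset.mem_univ f)
  have sst : ∀ c f m, s c f m ≤ st m := fun c f m => by
    rw [← hss c]; exact Finset.single_le_sum (f := fun f => s c f m) (fun f _ => h.s0 c f m) (Finset.mem_univ f)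
  have su : ∀ c f, Summable fun m => y c f m * ρ^m := fun c f =>
    Summable.of_nonneg_of_le (fun m => mul_nonneg (h.y0 c f m) (pow_pos hρ m).le)
      (fun m => mul_le_mul_of_nonneg_right (yb c f m) (pow_pos hρ m).le) hc.sb
  have sv : ∀ c f, Summable fun m => s c f m * ρ^m := fun c f =>
    Summable.of_nonneg_of_le (fun m => mul_nonneg (h.s0 c f m) (pow_pos hρ m).le)
      (fun m => mul_le_mul_of_nonneg_right (sst c f m) (pow_pos hρ m).le) hc.ss
  set Y : Bool → F → ℝ := fun c f => ∑' m, y c f m * ρ^m with hY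
  set S : Bool → F → ℝ := fun c f => ∑' m, s c f m * ρ^m with hS
  set τ := ∑' m, b m * ρ^m with hτ
  set σ := ∑' m, st m * ρ^m with hσ
  have Ysum : ∀ c, ∑ f, Y c f = τ := by
    intro c
    rw [hτ, hY, ← Summable.tsum_finsetSum fun f _ => su c f]
    simp_rw [← Finset.sum_mul, hyb]
  have Ssum : ∀ c, ∑ f, S c f = σ := by
    intro c
    rw [hσ, hS, ← Summable.tsum_finsetSum fun f _ => sv c f]
    simp_rw [← Finset.sum_mul, hss]
  have Y0 : ∀ c f, 0 ≤ Y c f := fun c f => tsum_nonneg fun m => mul_nonneg (h.y0 c f m) (pow_pos hρ m).le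
  have S0 : ∀ c f, 0 ≤ S c f := fun c f => tsum_nonneg fun m => mul_nonneg (h.s0 c f m) (pow_pos hρ m).le
  have τ0 : 0 ≤ τ := tsum_nonneg fun m => mul_nonneg (hc.b0 m) (pow_pos hρ m).le
  have Spos : ∀ c f, 0 < S c f := by
    intro c f
    obtain ⟨j, hj⟩ := h.hex c f
    exact (sv c f).tsum_pos (fun m => mul_nonneg (h.s0 c f m) (pow_pos hρ m).le) j
      (mul_pos hj (pow_pos hρ j))
  have Sle : ∀ c f, S c f ≤ σ := fun c f => by
    rw [← Ssum c]; exact Finset.single_le_sum (f := fun f => S c f) (fun f _ => S0 c f) (Finset.mem_univ f)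
  have crit : ρ * (σ + τ) + τ = 1 := hc.crit
  set δ := min (S true (ab true)) (S false (ab false)) with hδ
  have δ0 : 0 < δ := lt_min (Spos _ _) (Spos _ _)
  have δle : ∀ c, δ ≤ S c (ab c) := by
    intro c; cases c
    · exact min_le_right _ _
    · exact min_le_left _ _
  refine ⟨1 - ρ * δ, ?_, ?_, ?_⟩
  · have : ρ * δ ≤ ρ * σ := by gcongr; exact (δle true).trans (Sle _ _)
    have : 0 ≤ ρ * τ := by positivity
    linarith
  · have : 0 < ρ * δ := by positivity
    linarith
  rintro D ⟨d, d0, dosc, dsum⟩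
  set dY : Bool → F → ℝ := fun c f => ρ * d (!c) f with hdY
  set dS : Bool → F → ℝ := fun c f => dY c f + d c f with hdS
  have dY0 : ∀ c f, 0 ≤ dY c f := fun c f => mul_nonneg hρ.le (d0 _ _)
  have dS0 : ∀ c f, 0 ≤ dS c f := fun c f => add_nonneg (dY0 _ _) (d0 _ _)
  have ws : ∀ c f m, w c f m ≤ st m := fun c f m => by
    have h1 := sst c f m
    have h2 := h.y0 c f m
    rw [h.hs] at h1; linarith
  have oY : ∀ c f, OscLe (fun m => y c f m / b m) (dY c f) := by
    intro c f
    apply OscLe.shift 1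
    have h1 := (dosc (!c) f).mul_tendsto hc.rat hρ.le (M := 2 + 1/ρ) (by
      filter_upwards [hc.s_bdd _ (ws (!c) f)] with m hm
      rwa [abs_of_nonneg (div_nonneg (h.w0 _ _ _) (hc.b0 m))])
    refine h1.congr ?_
    filter_upwards [hc.bpos, eventually_ge_atTop 1] with m hm hm1
    rw [div_mul_div_cancel₀ hm.ne', h.hy, if_neg (by omega), zero_add]
  have oS : ∀ c f, OscLe (fun m => s c f m / b m) (dS c f) := by
    intro c f
    refine ((oY c f).add (dosc c f)).congr (Eventually.of_forall fun m => ?_)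
    rw [h.hs, add_div]
  have dYsum : ∀ c, ∑ f, dY c f ≤ ρ * D := by
    intro c; rw [← Finset.mul_sum]; exact mul_le_mul_of_nonneg_left (dsum _) hρ.le
  have dSsum : ∀ c, ∑ f, dS c f ≤ ρ * D + D := by
    intro c; rw [Finset.sum_add_distrib]; exact add_le_add (dYsum c) (dsum c)
  refine ⟨fun c f => ∑ k, if k = ab c then (if f = ab c then dS c k * τ else 0) else
      ∑ g, if op c g k = f then dY c g * S c k + dS c k * Y c g else 0, ?_, ?_, ?_⟩
  · intro c f
    refine Finset.sum_nonneg fun k _ => ?_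
    split_ifs
    · exact mul_nonneg (dS0 _ _) τ0
    · exact le_rfl
    · refine Finset.sum_nonneg fun g _ => ?_
      split_ifs
      · exact add_nonneg (mul_nonneg (dY0 _ _) (S0 _ _)) (mul_nonneg (dS0 _ _) (Y0 _ _))
      · exact le_rfl
  · intro c f
    have key := OscLe.sum (Finset.univ : Finset F)
      (x := fun k m => (if k = ab c then (if f = ab c then cv b (s c k) m else 0) else
        ∑ g, if op c g k = f then cv (y c g) (s c k) m else 0) / b m)
      (d := fun k => if k = ab c then (if f = ab c then dS c k * τ else 0) else
        ∑ g, if op c g k = f then dY c g * S c k + dS c k * Y c g else 0) (by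
      intro k _
      by_cases h1 : k = ab c
      · by_cases h2 : f = ab c
        · simp only [if_pos h1, if_pos h2]
          have := conv_osc hc b (s c k) 0 (dS c k) le_rfl (dS0 _ _) hc.b0 (h.s0 c k) (fun m => le_rfl)
            (sst c k) (OscLe.of_tendsto (b_lim hc)) (oS c k)
          rwa [zero_mul, zero_add] at this
        · simp only [if_pos h1, if_neg h2, zero_div]
          exact OscLe.zero
      · simp only [if_neg h1]
        have := OscLe.sum (Finset.univ : Finset F)
          (x := fun g m => (if op c g k = f then cv (y c g) (s c k) m else 0) / b m)
          (d := fun g => if op c g k = f then dY c g * S c k + dS c k * Y c g else 0) (by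
          intro g _
          by_cases h3 : op c g k = f
          · simp only [if_pos h3]
            exact conv_osc hc (y c g) (s c k) _ _ (dY0 _ _) (dS0 _ _) (h.y0 c g) (h.s0 c k) (yb c g)
              (sst c k) (oY c g) (oS c k)
          · simp only [if_neg h3, zero_div]
            exact OscLe.zero)
        refine this.congr (Eventually.of_forall fun m => ?_)
        rw [Finset.sum_div])
    refine key.congr (Eventually.of_forall fun m => ?_)
    rw [h.w_decomp b hyb, Finset.sum_div]
  · intro c
    rw [Finset.sum_comm]
    have e : ∀ k, (∑ f, if k = ab c then (if f = ab c then dS c k * τ else 0) else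
      ∑ g, if op c g k = f then dY c g * S c k + dS c k * Y c g else 0) = 
      (S c k - if k = ab c then S c k else 0) * (∑ g, dY c g) + dS c k * τ := by
      intro k
      by_cases h1 : k = ab c
      · simp [h1]
      · simp only [if_neg h1]
        rw [Finset.sum_comm]
        simp only [Finset.sum_ite_eq, Finset.mem_univ, if_true]
        rw [Finset.sum_add_distrib, ← Finset.sum_mul, ← Finset.mul_sum Finset.univ (fun g => Y c g), Ysum]
        ring
    simp only [e]
    rw [Finset.sum_add_distrib, ← Finset.sum_mul, ← Finset.sum_mul, Finset.sum_sub_distrib, Ssum]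
    simp only [Finset.sum_ite_eq', Finset.mem_univ, if_true]
    have h1 := dYsum c
    have h2 := dSsum c
    have h3 := Sle c (ab c)
    have h4 := δle c
    have h5 : 0 ≤ D := (Finset.sum_nonneg fun f _ => d0 c f).trans (dsum c)
    calc (σ - S c (ab c)) * (∑ g, dY c g) + (∑ f, dS c f) * τ 
        ≤ (σ - S c (ab c)) * (ρ * D) + (ρ * D + D) * τ := by
          gcongr
      _ ≤ (σ - δ) * (ρ * D) + (ρ * D + D) * τ := by gcongr
      _ = (1 - ρ * δ) * D := by linear_combination D * crit

theorem Sys.main (h : Sys n op ab l y w s) (hn : 1 ≤ n) :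
    ∃ (r : Bool → F → ℝ) (b : ℕ → ℝ), (∀ c f, 0 < r c f) ∧ (∀ᶠ m in atTop, 0 < b m) ∧
      (∀ c m, ∑ f, y c f m = b m) ∧ ∀ c f, Tendsto (fun m => y c f m / b m) atTop (𝓝 (r c f)) := by
  obtain ⟨ρ, b, st, hc, hyb, hss⟩ := h.crit hn
  have hρ := hc.ρ0
  have ws : ∀ c f m, w c f m ≤ st m := fun c f m => by
    have h1 : s c f m ≤ st m := by
      rw [← hss c]
      exact Finset.single_le_sum (f := fun f => s c f m) (fun f _ => h.s0 c f m) (Finset.mem_univ f)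
    have h2 := h.y0 c f m
    rw [h.hs] at h1; linarith
  obtain ⟨θ, θ0, θ1, hθ⟩ := h.step ρ b st hc hyb hss
  have hk : ∀ k : ℕ, ∃ d : Bool → F → ℝ, (∀ c f, 0 ≤ d c f) ∧ 
      (∀ c f, OscLe (fun m => w c f m / b m) (d c f)) ∧ 
        ∀ c, ∑ f, d c f ≤ θ^k * (Fintype.card F * (2 + 1/ρ)) := by
    intro k
    induction k with
    | zero =>
      refine ⟨fun _ _ => 2 + 1/ρ, fun _ _ => by positivity, fun c f => ?_, fun c => ?_⟩
      · apply OscLe.of_bdd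
        filter_upwards [hc.s_bdd _ (ws c f)] with m hm
        exact ⟨div_nonneg (h.w0 _ _ _) (hc.b0 m), hm⟩
      · simp [mul_add]
    | succ k ih =>
      have := hθ _ ih
      rwa [← mul_assoc, ← pow_succ'] at this
  have wosc : ∀ c f, OscLe (fun m => w c f m / b m) 0 := by
    intro c f
    apply OscLe.of_eps
    intro ε hε
    have t : Tendsto (fun k => θ^k * (Fintype.card F * (2 + 1/ρ))) atTop (𝓝 0) := by
      simpa using (tendsto_pow_atTop_nhds_zero_of_lt_one θ0 θ1).mul_const (Fintype.card F * (2 + 1/ρ))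
    obtain ⟨k, hk1⟩ := (t.eventually (gt_mem_nhds hε)).exists
    obtain ⟨d, d0, dosc, dsum⟩ := hk k
    refine (dosc c f).mono ?_
    have := Finset.single_le_sum (f := fun f => d c f) (fun f _ => d0 c f) (Finset.mem_univ f)
    have := dsum c
    simp only [zero_add]
    linarith
  choose q hq using fun c f => (wosc c f).tendsto
  have hr : ∀ c f, Tendsto (fun m => y c f m / b m) atTop (𝓝 (q (!c) f * ρ)) := by
    intro c f
    rw [← tendsto_add_atTop_iff_nat 1]
    refine ((hq (!c) f).mul hc.rat).congr' ?_
    filter_upwards [hc.bpos, eventually_ge_atTop 1] with m hm hm1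
    rw [div_mul_div_cancel₀ hm.ne', h.hy, if_neg (by omega), zero_add]
  have low : ∀ c g k j m, s c k j * y c g m ≤ cv (y c g) (s c k) (m + j) := by
    intro c g k j m
    have := Finset.single_le_sum (s := Finset.HasAntidiagonal.antidiagonal (m+j))
      (f := fun p => y c g p.1 * s c k p.2)
      (fun p _ => mul_nonneg (h.y0 _ _ _) (h.s0 _ _ _)) (a := (m, j)) (by simp)
    unfold cv
    refine le_trans (le_of_eq ?_) this
    ring
  have cv0 : ∀ c g k m, 0 ≤ cv (y c g) (s c k) m := fun c g k m =>
    Finset.sum_nonneg fun p _ => mul_nonneg (h.y0 _ _ _) (h.s0 _ _ _)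
  -- absorbing constants
  have qab : ∀ c, 0 < q c (ab c) := by
    intro c
    obtain ⟨j, hj⟩ := h.hex c (ab c)
    have t1 := (ratio_pow b ρ hc.bpos hc.rat j).const_mul (s c (ab c) j)
    have t2 := (tendsto_add_atTop_iff_nat j).2 (hq c (ab c))
    refine lt_of_lt_of_le (mul_pos hj (pow_pos hρ j)) (le_of_tendsto_of_tendsto' t1 t2 fun m => ?_)
    rw [mul_div_assoc']
    refine div_le_div_of_nonneg_right ?_ (hc.b0 _)
    rw [h.hw, ← hyb c, Finset.mul_sum]
    refine Finset.sum_le_sum fun g _ => ?_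
    refine (low c g (ab c) j m).trans ?_
    refine le_trans ?_ (Finset.single_le_sum (f := fun k => if op c g k = ab c then cv (y c g) (s c k) (m+j) else 0)
      (fun k _ => ?_) (Finset.mem_univ (ab c)))
    · simp [h.hab]
    · split_ifs
      · exact cv0 _ _ _ _
      · exact le_rfl
  have qpos : ∀ c f, 0 < q c f := by
    intro c f
    obtain ⟨j, hj⟩ := h.hex c f
    have t1 := ((hr c (ab (!c))).mul (ratio_pow b ρ hc.bpos hc.rat j)).const_mul (s c f j)
    have t2 := (tendsto_add_atTop_iff_nat j).2 (hq c f)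
    refine lt_of_lt_of_le (mul_pos hj (mul_pos (mul_pos (qab (!c)) hρ) (pow_pos hρ j)))
      (le_of_tendsto_of_tendsto t1 t2 ?_)
    filter_upwards [hc.bpos] with m hm
    rw [div_mul_div_cancel₀ hm.ne', mul_div_assoc']
    refine div_le_div_of_nonneg_right ?_ (hc.b0 _)
    refine (low c (ab (!c)) f j m).trans ?_
    rw [h.hw]
    refine le_trans ?_ (Finset.single_le_sum
      (f := fun g => ∑ k, if op c g k = f then cv (y c g) (s c k) (m+j) else 0)
      (fun g _ => Finset.sum_nonneg fun k _ => ?_) (Finset.mem_univ (ab (!c))))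
    · refine le_trans ?_ (Finset.single_le_sum
        (f := fun k => if op c (ab (!c)) k = f then cv (y c (ab (!c))) (s c k) (m+j) else 0)
        (fun k _ => ?_) (Finset.mem_univ f))
      · simp [h.hneu]
      · split_ifs
        · exact cv0 _ _ _ _
        · exact le_rfl
    · split_ifs
      · exact cv0 _ _ _ _
      · exact le_rfl
  exact ⟨fun c f => q (!c) f * ρ, b, fun c f => mul_pos (qpos _ _) hρ, hc.bpos, hyb, hr⟩

end

section Comb
variable {n : ℕ}

def bop (c : Bool) (g h : (Fin n → Bool) → Bool) : (Fin n → Bool) → Bool :=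
  fun x => if c then g x && h x else g x || h x

def OKt (c : Bool) (t : AT n) : Prop := WF t ∧ rootConn t ≠ some c

def setY (c : Bool) (f : (Fin n → Bool) → Bool) (m : ℕ) : Set (AT n) :=
  {t | OKt c t ∧ size t = m ∧ eval t = f}

def setL (k : ℕ) (c : Bool) (f : (Fin n → Bool) → Bool) (m : ℕ) : Set (List (AT n)) :=
  {l | k ≤ l.length ∧ (∀ t ∈ l, OKt c t) ∧ sizeList l = m ∧ evalList c l = f}

lemma size_pos' (t : AT n) : 1 ≤ size t := by
  cases t <;> simp [size]

lemma length_le_sizeList (l : List (AT n)) : l.length ≤ sizeList l := by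
  induction l with
  | nil => simp
  | cons t l ih =>
    have := size_pos' t
    simp only [List.length_cons, sizeList]; omega

lemma size_le_sizeList (l : List (AT n)) : ∀ t ∈ l, size t ≤ sizeList l := by
  induction l with
  | nil => simp
  | cons t l ih =>
    intro u hu
    simp only [sizeList]
    rcases List.mem_cons.1 hu with rfl | hu
    · omega
    · have := ih u hu; omega

lemma fin_list {α : Type*} (T : Set α) (hT : T.Finite) (k : ℕ) :
    {l : List α | l.length ≤ k ∧ ∀ t ∈ l, t ∈ T}.Finite := by
  induction k with
  | zero =>
    refine (Set.finite_singleton ([] : List α)).subset ?_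
    rintro l ⟨h, _⟩
    simpa using h
  | succ k ih =>
    refine ((Set.finite_singleton ([] : List α)).union (hT.image2 List.cons ih)).subset ?_
    rintro l ⟨h, h2⟩
    cases l with
    | nil => left; simp
    | cons a l =>
      right
      exact ⟨a, h2 a (by simp), l, ⟨by simpa using h, fun t ht => h2 t (by simp [ht])⟩, rfl⟩

lemma fin_tree (m : ℕ) : {t : AT n | size t ≤ m}.Finite := by
  induction m with
  | zero =>
    refine Set.finite_empty.subset ?_
    intro t ht
    have := size_pos' t
    simp at ht; omega
  | succ m ih =>
    refine ((Set.finite_range (fun p : Fin n × Bool => AT.leaf p.1 p.2)).union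
      (Set.Finite.image2 AT.node (Set.finite_univ (α := Bool)) (fin_list _ ih m))).subset ?_
    intro t ht
    cases t with
    | leaf i b => left; exact ⟨(i, b), rfl⟩
    | node c l =>
      right
      simp only [Set.mem_setOf_eq, size] at ht
      refine ⟨c, trivial, l, ⟨(length_le_sizeList l).trans (by omega), fun t h => ?_⟩, rfl⟩
      have := size_le_sizeList l t h
      simp only [Set.mem_setOf_eq]; omega

lemma finY (c f m) : (setY (n := n) c f m).Finite :=
  (fin_tree m).subset fun _ ht => ht.2.1.le

lemma finL (k c f m) : (setL (n := n) k c f m).Finite := by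
  refine (fin_list _ (fin_tree m) m).subset fun l hl => ?_
  obtain ⟨_, _, h, _⟩ := hl
  exact ⟨h ▸ length_le_sizeList l, fun t ht => h ▸ size_le_sizeList l t ht⟩

lemma evalList_cons (c : Bool) (t : AT n) (l : List (AT n)) :
    evalList c (t :: l) = bop c (eval t) (evalList c l) := by
  funext x; simp only [evalList, bop]

lemma evalList_single (c : Bool) (t : AT n) : evalList c [t] = eval t := by
  funext x; cases c <;> simp [evalList]

lemma evalList_append (c : Bool) (l l' : List (AT n)) :
    evalList c (l ++ l') = bop c (evalList c l) (evalList c l') := by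
  induction l with
  | nil => funext x; cases c <;> simp [evalList, bop]
  | cons t l ih =>
    rw [List.cons_append, evalList_cons, evalList_cons, ih]
    funext x; cases c <;> simp [bop, Bool.and_assoc, Bool.or_assoc]

lemma eval_node (c : Bool) (l : List (AT n)) : eval (.node c l) = evalList c l := by
  funext x; simp only [eval]

def leavesF (f : (Fin n → Bool) → Bool) : Set (AT n) := {t | ∃ i b, t = .leaf i b ∧ eval t = f}

lemma ncardY (c f m) : (setY (n := n) c f (m+1)).ncard =
    (if m = 0 then (leavesF f).ncard else 0) + (setL 2 (!c) f m).ncard := by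
  have e : setY (n := n) c f (m+1) = (if m = 0 then leavesF f else ∅) ∪ AT.node (!c) '' setL 2 (!c) f m := by
    ext t
    constructor
    · rintro ⟨⟨h1, h2⟩, h3, h4⟩
      cases t with
      | leaf i b =>
        left
        have : m = 0 := by simpa [size] using h3.symm
        rw [if_pos this]
        exact ⟨i, b, rfl, h4⟩
      | node d l =>
        right
        have hd : d = !c := by
          simp only [rootConn, ne_eq, Option.some.injEq] at h2
          cases c <;> cases d <;> simp_all
        subst hd
        cases h1 with
        | node _ _ q1 q2 q3 =>
        refine ⟨l, ⟨q1, fun t ht => ⟨q2 t ht, q3 t ht⟩, ?_, ?_⟩, rfl⟩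
        · simp only [size] at h3; omega
        · rw [← eval_node]; exact h4
    · rintro (h | ⟨l, ⟨h1, h2, h3, h4⟩, rfl⟩)
      · split_ifs at h with h0
        · obtain ⟨i, b, rfl, h⟩ := h
          subst h0
          exact ⟨⟨WF.leaf i b, by simp [rootConn]⟩, by simp [size], h⟩
        · exact absurd h (Set.notMem_empty _)
      · refine ⟨⟨WF.node _ _ h1 (fun t ht => (h2 t ht).1) (fun t ht => (h2 t ht).2), ?_⟩, ?_, ?_⟩
        · cases c <;> simp [rootConn]
        · simp only [size]; omega
        · rw [eval_node]; exact h4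
  have hf := finY (n := n) c f (m+1)
  rw [e] at hf ⊢
  rw [Set.ncard_union_eq ?_ (hf.subset Set.subset_union_left) (hf.subset Set.subset_union_right),
    Set.ncard_image_of_injective _ (fun a b h => by injection h)]
  · congr 1
    split_ifs <;> simp
  · rw [Set.disjoint_left]
    rintro t h1 ⟨l, _, rfl⟩
    split_ifs at h1
    · obtain ⟨i, b, h, _⟩ := h1
      cases h
    · exact h1

lemma ncardY0 (c f) : (setY (n := n) c f 0).ncard = 0 := by
  rw [Set.ncard_eq_zero (finY _ _ _)]
  ext t
  simp only [Set.mem_empty_iff_false, iff_false]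
  rintro ⟨_, h, _⟩
  have := size_pos' t
  omega

lemma ncardS (c f m) : (setL (n := n) 1 c f m).ncard = (setY c f m).ncard + (setL 2 c f m).ncard := by
  have e : setL (n := n) 1 c f m = (fun t => [t]) '' setY c f m ∪ setL 2 c f m := by
    ext l
    constructor
    · rintro ⟨h1, h2, h3, h4⟩
      match l, h1, h2, h3, h4 with
      | [], h1, _, _, _ => simp at h1
      | [t], _, h2, h3, h4 =>
        left
        refine ⟨t, ⟨h2 t (by simp), ?_, ?_⟩, rfl⟩
        · simpa [sizeList] using h3
        · rwa [evalList_single] at h4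
      | t :: u :: l, _, h2, h3, h4 =>
        right
        exact ⟨by simp, h2, h3, h4⟩
    · rintro (⟨t, ⟨h1, h2, h3⟩, rfl⟩ | ⟨h1, h2⟩)
      · exact ⟨by simp, by simpa using h1, by simpa [sizeList] using h2, by rwa [evalList_single]⟩
      · exact ⟨by omega, h2⟩
  have hf := finL (n := n) 1 c f m
  rw [e] at hf ⊢
  rw [Set.ncard_union_eq ?_ (hf.subset Set.subset_union_left) (hf.subset Set.subset_union_right),
    Set.ncard_image_of_injective _ (fun a b h => by simpa using h)]
  rw [Set.disjoint_left]
  rintro t ⟨l, _, rfl⟩ ⟨h, _⟩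
  simp at h

lemma ncardW (c : Bool) (f : (Fin n → Bool) → Bool) (m : ℕ) : (setL (n := n) 2 c f m).ncard =
    ∑ g, ∑ h, if bop c g h = f then
      ∑ p ∈ Finset.HasAntidiagonal.antidiagonal m, (setY c g p.1).ncard * (setL 1 c h p.2).ncard else 0 := by
  classical
  set T : Finset ((((Fin n → Bool) → Bool) × ((Fin n → Bool) → Bool)) × (ℕ × ℕ)) :=
    ((Finset.univ ×ˢ Finset.univ).filter fun q => bop c q.1 q.2 = f) ×ˢ Finset.HasAntidiagonal.antidiagonal m with hT
  set U : ((((Fin n → Bool) → Bool) × ((Fin n → Bool) → Bool)) × (ℕ × ℕ)) → Finset (List (AT n)) := fun q =>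
    ((finY c q.1.1 q.2.1).toFinset ×ˢ (finL 1 c q.1.2 q.2.2).toFinset).image (fun z => z.1 :: z.2) with hU
  have memU : ∀ q l, l ∈ U q ↔ ∃ t l', t ∈ setY c q.1.1 q.2.1 ∧ l' ∈ setL 1 c q.1.2 q.2.2 ∧ t :: l' = l := by
    intro q l
    simp only [hU, Finset.mem_image, Finset.mem_product, Set.Finite.mem_toFinset, Prod.exists]
    constructor
    · rintro ⟨a, b, ⟨h1, h2⟩, h3⟩; exact ⟨a, b, h1, h2, h3⟩
    · rintro ⟨a, b, h1, h2, h3⟩; exact ⟨a, b, ⟨h1, h2⟩, h3⟩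
  have e : (finL (n := n) 2 c f m).toFinset = T.biUnion U := by
    ext l
    rw [Set.Finite.mem_toFinset, Finset.mem_biUnion]
    simp only [memU]
    constructor
    · rintro ⟨h1, h2, h3, h4⟩
      cases l with
      | nil => simp at h1
      | cons t l =>
        refine ⟨((eval t, evalList c l), (size t, sizeList l)), ?_, t, l, ⟨h2 t (by simp), rfl, rfl⟩,
          ⟨by simpa using h1, fun u hu => h2 u (by simp [hu]), rfl, rfl⟩, rfl⟩
        simp only [hT, Finset.mem_product, Finset.mem_filter, Finset.mem_univ, true_and,
          Finset.HasAntidiagonal.mem_antidiagonal]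
        refine ⟨?_, ?_⟩
        · rw [← evalList_cons]; exact h4
        · simpa [sizeList] using h3
    · rintro ⟨⟨⟨g, h⟩, ⟨i, j⟩⟩, hq, t, l', ⟨h1, h2, h3⟩, ⟨h4, h5, h6, h7⟩, rfl⟩
      simp only [hT, Finset.mem_product, Finset.mem_filter, Finset.mem_univ, true_and,
          Finset.HasAntidiagonal.mem_antidiagonal] at hq h2 h3 h6 h7
      refine ⟨by simpa using h4, ?_, ?_, ?_⟩
      · intro u hu
        rcases List.mem_cons.1 hu with rfl | hu
        · exact h1
        · exact h5 u hu
      · simp only [sizeList]; omega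
      · rw [evalList_cons, h3, h7]; exact hq.1
  rw [Set.ncard_eq_toFinset_card _ (finL _ _ _ _), e, Finset.card_biUnion]
  · rw [hT, Finset.sum_product, Finset.sum_filter, Finset.sum_product]
    refine Finset.sum_congr rfl fun g _ => Finset.sum_congr rfl fun h _ => ?_
    split_ifs
    · refine Finset.sum_congr rfl fun p _ => ?_
      simp only [hU]
      rw [Finset.card_image_of_injective, Finset.card_product, Set.ncard_eq_toFinset_card _ (finL _ _ _ _),
        Set.ncard_eq_toFinset_card _ (finY _ _ _)]
      rintro ⟨a, b⟩ ⟨a', b'⟩ h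
      simpa using h
    · rfl
  · rintro ⟨⟨g, h⟩, ⟨i, j⟩⟩ _ ⟨⟨g', h'⟩, ⟨i', j'⟩⟩ _ hne
    rw [Function.onFun, Finset.disjoint_left]
    intro l hl hl'
    rw [memU] at hl hl'
    obtain ⟨t, l1, ⟨_, h2, h3⟩, ⟨_, _, h6, h7⟩, rfl⟩ := hl
    obtain ⟨t', l1', ⟨_, k2, k3⟩, ⟨_, _, k6, k7⟩, hh⟩ := hl'
    injection hh with ha hb
    subst ha; subst hb
    apply hne
    simp only at h2 h3 h6 h7 k2 k3 k6 k7
    rw [← h2, ← h3, ← h6, ← h7, ← k2, ← k3, ← k6, ← k7]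

lemma sum_leaves : ∑ f : (Fin n → Bool) → Bool, (leavesF f).ncard = 2 * n := by
  classical
  have h : ∀ f : (Fin n → Bool) → Bool, (leavesF f).ncard =
      (Finset.univ.filter fun p : Fin n × Bool => eval (AT.leaf p.1 p.2) = f).card := by
    intro f
    have e : leavesF f = (fun p : Fin n × Bool => AT.leaf p.1 p.2) ''
      ((Finset.univ.filter fun p : Fin n × Bool => eval (AT.leaf p.1 p.2) = f : Finset _) : Set (Fin n × Bool)) := by
      ext t
      simp only [leavesF, Set.mem_setOf_eq, Set.mem_image, Finset.coe_filter, Finset.mem_univ, true_and, Prod.exists]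
      constructor
      · rintro ⟨i, b, rfl, h⟩; exact ⟨i, b, h, rfl⟩
      · rintro ⟨i, b, h, rfl⟩; exact ⟨i, b, rfl, h⟩
    rw [e, Set.ncard_image_of_injective, Set.ncard_coe_finset]
    rintro ⟨a, b⟩ ⟨a', b'⟩ h
    simpa using h
  simp_rw [h]
  rw [← Finset.card_eq_sum_card_fiberwise (s := Finset.univ) (t := Finset.univ) (by simp)]
  simp [mul_comm]

/-- expressibility -/
def Expr (f : (Fin n → Bool) → Bool) : Prop :=
  ∀ c, ∃ l : List (AT n), 1 ≤ l.length ∧ (∀ t ∈ l, OKt c t) ∧ evalList c l = f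

lemma Expr.bop {f g : (Fin n → Bool) → Bool} (c : Bool) (hf : Expr f) (hg : Expr g) : Expr (bop c f g) := by
  obtain ⟨l, h1, h2, h3⟩ := hf c
  obtain ⟨l', k1, k2, k3⟩ := hg c
  have hall : ∀ t ∈ l ++ l', OKt c t := by
    intro t ht
    rcases List.mem_append.1 ht with ht | ht
    · exact h2 t ht
    · exact k2 t ht
  have hev : evalList c (l ++ l') = _root_.bop c f g := by rw [evalList_append, h3, k3]
  have hlen : 2 ≤ (l ++ l').length := by rw [List.length_append]; omega
  intro d
  by_cases hd : d = c
  · subst hd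
    exact ⟨l ++ l', by omega, hall, hev⟩
  · refine ⟨[.node c (l ++ l')], by simp, ?_, ?_⟩
    · intro t ht
      obtain rfl := List.mem_singleton.1 ht
      refine ⟨WF.node _ _ hlen (fun t ht => (hall t ht).1) (fun t ht => (hall t ht).2), ?_⟩
      simp only [rootConn, ne_eq, Option.some.injEq]
      exact fun h => hd h.symm
    · rw [evalList_single, eval_node, hev]

lemma Expr.lit (i : Fin n) (b : Bool) : Expr (eval (AT.leaf i b)) := by
  intro c
  refine ⟨[.leaf i b], by simp, ?_, by rw [evalList_single]⟩
  intro t ht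
  obtain rfl := List.mem_singleton.1 ht
  exact ⟨WF.leaf i b, by simp [rootConn]⟩

lemma Expr.const (hn : 1 ≤ n) (c : Bool) : Expr (fun _ : Fin n → Bool => c) := by
  have h := (Expr.lit (⟨0, hn⟩ : Fin n) true).bop (!c) (Expr.lit (⟨0, hn⟩ : Fin n) false)
  convert h using 1
  funext x
  cases c <;> simp [_root_.bop, eval]

lemma Expr.all (hn : 1 ≤ n) (f : (Fin n → Bool) → Bool) : Expr f := by
  classical
  have h1 : ∀ (v : Fin n → Bool) (t : Finset (Fin n)), Expr (fun x => decide (∀ i ∈ t, x i = v i)) := by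
    intro v t
    induction t using Finset.induction_on with
    | empty => simpa using Expr.const hn true
    | insert a t ha ih =>
      convert (Expr.lit a (v a)).bop true ih using 1
      funext x
      simp only [_root_.bop, eval, Finset.forall_mem_insert]
      cases v a <;> cases x a <;> simp
  have h2 : ∀ t : Finset (Fin n → Bool), Expr (fun x => decide (x ∈ t)) := by
    intro t
    induction t using Finset.induction_on with
    | empty => simpa using Expr.const hn false
    | insert v t ha ih =>
      convert (h1 v Finset.univ).bop false ih using 1
      funext x
      simp [_root_.bop, funext_iff]
  convert h2 (Finset.univ.filter fun x => f x = true) using 1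
  funext x
  simp

lemma theSys (hn : 1 ≤ n) : Sys (F := (Fin n → Bool) → Bool) n bop (fun c _ => !c)
    (fun f => ((leavesF f).ncard : ℝ)) (fun c f m => ((setY c f m).ncard : ℝ))
    (fun c f m => ((setL 2 c f m).ncard : ℝ)) (fun c f m => ((setL 1 c f m).ncard : ℝ)) where
  hab c g := by funext x; cases c <;> simp [bop]
  hneu c g := by funext x; cases c <;> simp [bop]
  y0 _ _ _ := Nat.cast_nonneg _
  w0 _ _ _ := Nat.cast_nonneg _
  hs c f m := by rw [ncardS]; push_cast; rfl
  hyz c f := by rw [ncardY0]; simp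
  hy c f m := by rw [ncardY]; push_cast; rfl
  hw c f m := by
    rw [ncardW]
    push_cast
    rfl
  hl := by rw [← Nat.cast_sum, sum_leaves]; push_cast; rfl
  hex c f := by
    obtain ⟨l, h1, h2, h3⟩ := Expr.all hn f c
    refine ⟨sizeList l, ?_⟩
    rw [Nat.cast_pos, Set.ncard_pos (finL _ _ _ _)]
    exact ⟨l, h1, h2, rfl, h3⟩

lemma countIn_eq (f : (Fin n → Bool) → Bool) (m : ℕ) (hm : 2 ≤ m) :
    countIn n {t | eval t = f} m = (setY true f m).ncard + (setY false f m).ncard := by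
  have e : {t : AT n | t ∈ {t | eval t = f} ∧ WF t ∧ size t = m} = setY true f m ∪ setY false f m := by
    ext t
    constructor
    · rintro ⟨h1, h2, h3⟩
      cases t with
      | leaf i b => simp [size] at h3; omega
      | node c l =>
        cases c
        · left; exact ⟨⟨h2, by simp [rootConn]⟩, h3, h1⟩
        · right; exact ⟨⟨h2, by simp [rootConn]⟩, h3, h1⟩
    · rintro (⟨⟨h1, _⟩, h2, h3⟩ | ⟨⟨h1, _⟩, h2, h3⟩) <;> exact ⟨h3, h1, h2⟩
  have : countIn n {t | eval t = f} m = {t : AT n | t ∈ {t | eval t = f} ∧ WF t ∧ size t = m}.ncard := rfl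
  rw [this, e, Set.ncard_union_eq ?_ (finY _ _ _) (finY _ _ _)]
  rw [Set.disjoint_left]
  rintro t ⟨⟨_, h1⟩, h2, _⟩ ⟨⟨_, h3⟩, _, _⟩
  cases t with
  | leaf i b => simp [size] at h2; omega
  | node c l => cases c <;> simp [rootConn] at h1 h3

lemma A_eq (m : ℕ) : A n m = ∑ f : (Fin n → Bool) → Bool, countIn n {t | eval t = f} m := by
  classical
  have fin : {t : AT n | WF t ∧ size t = m}.Finite := (fin_tree m).subset fun t ht => ht.2.le
  have h1 : A n m = {t : AT n | t ∈ Set.univ ∧ WF t ∧ size t = m}.ncard := rfl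
  have h2 : ∀ f, countIn n {t | eval t = f} m = {t : AT n | t ∈ {t | eval t = f} ∧ WF t ∧ size t = m}.ncard :=
    fun _ => rfl
  have e : {t : AT n | t ∈ Set.univ ∧ WF t ∧ size t = m} = {t : AT n | WF t ∧ size t = m} := by ext; simp
  rw [h1, e, Set.ncard_eq_toFinset_card _ fin,
    Finset.card_eq_sum_card_fiberwise (f := fun t => eval t) (t := Finset.univ) (by simp)]
  refine Finset.sum_congr rfl fun f _ => ?_
  rw [h2, ← Set.ncard_coe_finset]
  congr 1
  ext t
  simp only [Finset.coe_filter, Set.Finite.mem_toFinset, Set.mem_setOf_eq]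
  tauto

end Comb

/-- For every integer `n ≥ 1` and every Boolean function `f` of `n` variables,
the limit `P_n(f) = lim_{m→∞} P_{m,n}(f)` exists and is strictly positive. -/
theorem statement0 (n : ℕ) (hn : 1 ≤ n) (f : (Fin n → Bool) → Bool) :
    ∃ p : ℝ, 0 < p ∧ Filter.Tendsto (fun m => Pmn n m f) Filter.atTop (nhds p) := by
  obtain ⟨r, b, r0, bpos, hyb, hr⟩ := (theSys hn).main hn
  refine ⟨(r true f + r false f) / 2, by linarith [r0 true f, r0 false f, half_pos (add_pos (r0 true f) (r0 false f))], ?_⟩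
  refine (((hr true f).add (hr false f)).div_const 2).congr' ?_
  filter_upwards [bpos, eventually_ge_atTop 2] with m hm hm2
  have hA : (A n m : ℝ) = 2 * b m := by
    rw [A_eq]
    simp_rw [countIn_eq _ m hm2]
    push_cast
    rw [Finset.sum_add_distrib, hyb true m, hyb false m]
    ring
  unfold Pmn
  rw [hA, countIn_eq f m hm2]
  push_cast
  field_simp
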